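/- arXiv:1408.0589 — 2 statements merged into one kernel-verified Lean document; each statement's English description precedes it below -/
import Mathlib

section
/- Let θ : W → W be a group automorphism mapping S onto itself with θ ∘ θ = id, and let 𝒦 ⊆ W be a θ-twisted conjugacy class such that θ(x) = x⁻¹ for all x ∈ 𝒦 and such that 𝒦 (with height ht = ℓ/2) is quasiparabolic. Set ℓ₀ = min{ℓ(y) : y ∈ 𝒦}, and note x⁻¹ = θ(x) ∈ 𝒦 for x ∈ 𝒦. Then the module ℳ on X = 𝒦 has a bar operator β, and it satisfies: for every x ∈ 𝒦 and every reduced word s₁,…,s_k for x (i.e. x = s₁⋯s_k with each s_i ∈ S and k = ℓ(x)), β(M_x) = v^{ℓ₀} · (T_{s₁} + (v⁻¹ − v)) ∘ ⋯ ∘ (T_{s_k} + (v⁻¹ − v)) (M_{x⁻¹}). Likewise the module 𝒩 on 𝒦 has a bar operator β′ satisfying β′(N_x) = (−1)^{ℓ₀} · v^{−ℓ₀} · (U_{s₁} + (v⁻¹ − v)) ∘ ⋯ ∘ (U_{s_k} + (v⁻¹ − v)) (N_{x⁻¹}) for every such reduced word. -/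
noncomputable section

open LaurentPolynomial

/-- The Laurent polynomial ring `A = ℤ[v,v⁻¹]`. -/
abbrev A : Type := LaurentPolynomial ℤ

/-- The element `v`. -/
def v : A := T 1

/-- The element `v⁻¹`. -/
def vinv : A := T (-1)

/-- The bar involution of `A`, sending `v ↦ v⁻¹`. -/
def Abar : A → A := LaurentPolynomial.invert

/-- The set `v⁻¹·ℤ[v⁻¹] ⊆ A`. -/
def negPart : Set A := { f | ∃ p : Polynomial ℤ, f = Polynomial.aeval vinv (Polynomial.X * p) }

variable {B W : Type*} [Group W] {M : CoxeterMatrix B} {X : Type*}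

/-- `σ : W → X → X` is a group action of `W` on `X`. -/
def IsActionOf (σ : W → X → X) : Prop :=
  (∀ x, σ 1 x = x) ∧ ∀ w w' x, σ (w * w') x = σ w (σ w' x)

/-- `(X, ht)` is a scaled `W`-set (relative to the action `σ`). -/
def IsScaled (cs : CoxeterSystem M W) (σ : W → X → X) (ht : X → ℚ) : Prop :=
  ∀ (i : B) (x : X), ht (σ (cs.simple i) x) - ht x ∈ ({-1, 0, 1} : Set ℚ)

/-- `(X, ht)` is a quasiparabolic `W`-set. -/
def IsQP (cs : CoxeterSystem M W) (σ : W → X → X) (ht : X → ℚ) : Prop :=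
  IsScaled cs σ ht ∧
  (∀ r : W, cs.IsReflection r → ∀ x : X, ht (σ r x) = ht x → σ r x = x) ∧
  (∀ r : W, cs.IsReflection r → ∀ (x : X) (i : B),
      ht x < ht (σ r x) → ht (σ (cs.simple i) (σ r x)) < ht (σ (cs.simple i) x) →
      σ r x = σ (cs.simple i) x)

/-- `x` is a `W`-minimal element of `X`. -/
def WMin (cs : CoxeterSystem M W) (σ : W → X → X) (ht : X → ℚ) (x : X) : Prop :=
  ∀ i : B, ht x ≤ ht (σ (cs.simple i) x)

/-- Every `W`-orbit of `X` contains a `W`-minimal element. -/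
def BoundedBelow (cs : CoxeterSystem M W) (σ : W → X → X) (ht : X → ℚ) : Prop :=
  ∀ x : X, ∃ w : W, WMin cs σ ht (σ w x)

/-- The strict Bruhat order on a quasiparabolic set. -/
def bruhatLT (cs : CoxeterSystem M W) (σ : W → X → X) (ht : X → ℚ) : X → X → Prop :=
  Relation.TransGen fun a b => ∃ r : W, cs.IsReflection r ∧ b = σ r a ∧ ht a < ht b

/-- The standard basis element `M_x` (also `N_x`) of the free `A`-module on `X`. -/
def Mstd (x : X) : X →₀ A := Finsupp.single x 1

/-- The operator `T_s` on the module `ℳ`. -/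
def Ts (cs : CoxeterSystem M W) (σ : W → X → X) (ht : X → ℚ) (i : B) :
    (X →₀ A) →ₗ[A] (X →₀ A) :=
  Finsupp.lift (X →₀ A) A X fun x =>
    if ht x < ht (σ (cs.simple i) x) then Mstd (σ (cs.simple i) x)
    else if ht (σ (cs.simple i) x) < ht x then Mstd (σ (cs.simple i) x) + (v - vinv) • Mstd x
    else v • Mstd x

/-- The operator `U_s` on the module `𝒩`. -/
def Us (cs : CoxeterSystem M W) (σ : W → X → X) (ht : X → ℚ) (i : B) :
    (X →₀ A) →ₗ[A] (X →₀ A) :=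
  Finsupp.lift (X →₀ A) A X fun x =>
    if ht x < ht (σ (cs.simple i) x) then Mstd (σ (cs.simple i) x)
    else if ht (σ (cs.simple i) x) < ht x then Mstd (σ (cs.simple i) x) + (v - vinv) • Mstd x
    else (-vinv) • Mstd x

/-- A bar operator on the module `ℳ`. -/
def IsBarOpM (cs : CoxeterSystem M W) (σ : W → X → X) (ht : X → ℚ)
    (β : (X →₀ A) → (X →₀ A)) : Prop :=
  (∀ m m', β (m + m') = β m + β m') ∧
  (∀ (f : A) (m : X →₀ A), β (f • m) = Abar f • β m) ∧
  (∀ (i : B) (m : X →₀ A), β (Ts cs σ ht i m) = Ts cs σ ht i (β m) + (vinv - v) • β m) ∧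
  (∀ x : X, WMin cs σ ht x → β (Mstd x) = Mstd x)

/-- A bar operator on the module `𝒩`. -/
def IsBarOpN (cs : CoxeterSystem M W) (σ : W → X → X) (ht : X → ℚ)
    (β : (X →₀ A) → (X →₀ A)) : Prop :=
  (∀ n n', β (n + n') = β n + β n') ∧
  (∀ (f : A) (n : X →₀ A), β (f • n) = Abar f • β n) ∧
  (∀ (i : B) (n : X →₀ A), β (Us cs σ ht i n) = Us cs σ ht i (β n) + (vinv - v) • β n) ∧
  (∀ x : X, WMin cs σ ht x → β (Mstd x) = Mstd x)

/-- The `θ`-twisted conjugation action of `W` on itself: `w • x = w·x·θ(w)⁻¹`. -/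
def twConj (θ : W ≃* W) (w x : W) : W := w * x * (θ w)⁻¹

/-- The height function `ht = ℓ/2` on `W`. -/
def htL (cs : CoxeterSystem M W) (x : W) : ℚ := (cs.length x : ℚ) / 2

/-- `𝒦` is a `θ`-twisted conjugacy class, i.e. an orbit of the twisted conjugation action. -/
def IsTwClass (θ : W ≃* W) (𝒦 : Set W) : Prop :=
  ∃ x₀ : W, 𝒦 = Set.range fun w => twConj θ w x₀

/-- The `θ`-twisted conjugacy class `𝒦` is quasiparabolic with respect to the height
function `ht = ℓ/2`: (QP1) and (QP2) hold. -/
def IsQPClass (cs : CoxeterSystem M W) (θ : W ≃* W) (𝒦 : Set W) : Prop :=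
  (∀ r : W, cs.IsReflection r → ∀ x ∈ 𝒦,
      htL cs (twConj θ r x) = htL cs x → twConj θ r x = x) ∧
  (∀ r : W, cs.IsReflection r → ∀ x ∈ 𝒦, ∀ i : B,
      htL cs x < htL cs (twConj θ r x) →
      htL cs (twConj θ (cs.simple i) (twConj θ r x)) < htL cs (twConj θ (cs.simple i) x) →
      twConj θ r x = twConj θ (cs.simple i) x)

/-- `x` is a `W`-minimal element: `ℓ(s·x·θ(s)⁻¹) ≥ ℓ(x)` for all simple reflections `s`. -/
def TwMin (cs : CoxeterSystem M W) (θ : W ≃* W) (x : W) : Prop :=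
  ∀ i : B, cs.length x ≤ cs.length (twConj θ (cs.simple i) x)

/-- The automorphism `θ` maps the set `S` of simple reflections onto itself. -/
def SimpleOnto (cs : CoxeterSystem M W) (θ : W ≃* W) : Prop :=
  ⇑θ '' Set.range cs.simple = Set.range cs.simple

/-- The operator `T̄_s = T_s + (v⁻¹ − v)`, an endomorphism of `ℳ`. -/
def TsBar (cs : CoxeterSystem M W) (σ : W → X → X) (ht : X → ℚ) (i : B) :
    Module.End A (X →₀ A) :=
  Ts cs σ ht i + (vinv - v) • (LinearMap.id : (X →₀ A) →ₗ[A] (X →₀ A))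

/-- The operator `Ū_s = U_s + (v⁻¹ − v)`, an endomorphism of `𝒩`. -/
def UsBar (cs : CoxeterSystem M W) (σ : W → X → X) (ht : X → ℚ) (i : B) :
    Module.End A (X →₀ A) :=
  Us cs σ ht i + (vinv - v) • (LinearMap.id : (X →₀ A) →ₗ[A] (X →₀ A))

section Coxeter

namespace CoxeterSystem

variable (cs : CoxeterSystem M W)

theorem _root_.Function.End.mul_apply {α : Type*} (f g : Function.End α) (x : α) :
    (f * g) x = f (g x) := rfl

theorem _root_.Function.End.one_apply {α : Type*} (x : α) : (1 : Function.End α) x = x := rfl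

open Classical in
/-- The simple reflection `s i` acting on pairs of a group element and a sign. -/
def signedConj (i : B) : Function.End (W × ZMod 2) := fun p =>
  (cs.simple i * p.1 * cs.simple i, p.2 + if p.1 = cs.simple i then 1 else 0)

open Classical in
theorem signedConj_mul_pow (i j : B) (n : ℕ) (t : W) (e : ZMod 2) :
    ((cs.signedConj i * cs.signedConj j) ^ n) (t, e) =
      ((cs.simple i * cs.simple j) ^ n * t * (cs.simple j * cs.simple i) ^ n,
        e + ∑ k ∈ Finset.range (2 * n),
          if t = (cs.simple j * cs.simple i) ^ k * cs.simple j then 1 else 0) := by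
  induction n with
  | zero => simp [Function.End.one_apply]
  | succ n ih =>
    rw [pow_succ', Function.End.mul_apply, ih, Function.End.mul_apply]
    have hinv : ((cs.simple i * cs.simple j) ^ n)⁻¹ = (cs.simple j * cs.simple i) ^ n := by
      rw [← inv_pow]; simp
    have hsemi : ∀ m, cs.simple j * (cs.simple i * cs.simple j) ^ m =
        (cs.simple j * cs.simple i) ^ m * cs.simple j := by
      intro m
      induction m with
      | zero => simp
      | succ m ihm => rw [pow_succ, ← mul_assoc, ihm, pow_succ]; simp only [mul_assoc]
    have key : ∀ z : W, (cs.simple i * cs.simple j) ^ n * t * (cs.simple j * cs.simple i) ^ n = z ↔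
        t = (cs.simple j * cs.simple i) ^ n * z * (cs.simple i * cs.simple j) ^ n := by
      intro z
      rw [← hinv]
      constructor
      · rintro rfl; group
      · rintro rfl; group
    have hj : (cs.simple j * cs.simple i) ^ n * cs.simple j * (cs.simple i * cs.simple j) ^ n =
        (cs.simple j * cs.simple i) ^ (2 * n) * cs.simple j := by
      rw [mul_assoc, hsemi, two_mul, pow_add, mul_assoc]
    have hi : (cs.simple j * cs.simple i) ^ n * (cs.simple j * cs.simple i * cs.simple j) *
        (cs.simple i * cs.simple j) ^ n =
        (cs.simple j * cs.simple i) ^ (2 * n + 1) * cs.simple j := by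
      calc _ = (cs.simple j * cs.simple i) ^ n * ((cs.simple j * cs.simple i) *
            (cs.simple j * (cs.simple i * cs.simple j) ^ n)) := by simp only [mul_assoc]
        _ = _ := by
          rw [hsemi, two_mul, pow_succ, pow_add]
          simp only [← mul_assoc]
          rw [mul_assoc ((cs.simple j * cs.simple i) ^ n) (cs.simple j) (cs.simple i)]
          rw [mul_assoc ((cs.simple j * cs.simple i) ^ n), ← pow_succ', pow_succ]
          simp only [← mul_assoc]
    have hsi : ∀ y : W, cs.simple j * y * cs.simple j = cs.simple i ↔
        y = cs.simple j * cs.simple i * cs.simple j := by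
      intro y
      constructor
      · intro h; rw [← h]; simp [mul_assoc]
      · rintro rfl; simp [mul_assoc]
    simp only [signedConj]
    refine Prod.ext ?_ ?_
    · simp only [pow_succ', pow_succ (cs.simple j * cs.simple i) n]
      simp only [mul_assoc]
    · rw [show 2 * (n + 1) = 2 * n + 1 + 1 by ring, Finset.sum_range_succ, Finset.sum_range_succ]
      simp only [hsi, key, hj, hi, add_assoc]

theorem isLiftable_signedConj : M.IsLiftable cs.signedConj := by
  classical
  intro i j
  funext ⟨t, e⟩
  rw [signedConj_mul_pow, two_mul, Finset.sum_range_add]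
  have hz : ∀ x : ZMod 2, x + x = 0 := by decide
  simp [pow_add, hz, Function.End.one_apply]

theorem lift_signedConj_wordProd (l : List B) (t : W) :
    ((cs.lift ⟨_, cs.isLiftable_signedConj⟩ (cs.wordProd l)) (t, 0)).1 =
        cs.wordProd l * t * (cs.wordProd l)⁻¹ ∧
      (t ∉ cs.rightInvSeq l →
        ((cs.lift ⟨_, cs.isLiftable_signedConj⟩ (cs.wordProd l)) (t, 0)).2 = 0) := by
  induction l with
  | nil => simp [Function.End.one_apply]
  | cons i l ih =>
    rw [wordProd_cons, map_mul, lift_apply_simple, Function.End.mul_apply]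
    refine ⟨?_, ?_⟩
    · simp only [signedConj, ih.1]
      simp [mul_assoc]
    · intro ht
      simp only [rightInvSeq, List.mem_cons, not_or] at ht
      simp only [signedConj, ih.1, ih.2 ht.2, zero_add, ite_eq_right_iff]
      intro h
      exact absurd (by rw [← h]; group) ht.1

/-- The exchange property for a right descent. -/
theorem exists_wordProd_eraseIdx_of_isRightDescent (l : List B) {i : B}
    (h : cs.IsRightDescent (cs.wordProd l) i) :
    ∃ k < l.length, cs.wordProd l * cs.simple i = cs.wordProd (l.eraseIdx k) := by
  by_cases hm : cs.simple i ∈ cs.rightInvSeq l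
  · obtain ⟨k, hk, hki⟩ := List.mem_iff_getElem.1 hm
    rw [length_rightInvSeq] at hk
    refine ⟨k, hk, ?_⟩
    rw [← wordProd_mul_getD_rightInvSeq, ← hki, List.getD_eq_getElem]
  · exfalso
    obtain ⟨l', hl', hw⟩ := cs.exists_isReduced (cs.wordProd l * cs.simple i)
    have h0 := (cs.lift_signedConj_wordProd l (cs.simple i)).2 hm
    have hm' : cs.simple i ∈ cs.rightInvSeq l' := by
      by_contra hm'
      have h1 := (cs.lift_signedConj_wordProd l' (cs.simple i)).2 hm'
      rw [← hw, map_mul, lift_apply_simple, Function.End.mul_apply] at h1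
      have hadd : ∀ (m : List B) (t : W) (e : ZMod 2),
          ((cs.lift ⟨_, cs.isLiftable_signedConj⟩ (cs.wordProd m)) (t, e)).1 =
            ((cs.lift ⟨_, cs.isLiftable_signedConj⟩ (cs.wordProd m)) (t, 0)).1 ∧
          ((cs.lift ⟨_, cs.isLiftable_signedConj⟩ (cs.wordProd m)) (t, e)).2 =
            ((cs.lift ⟨_, cs.isLiftable_signedConj⟩ (cs.wordProd m)) (t, 0)).2 + e := by
        intro m t e
        induction m with
        | nil => simp [Function.End.one_apply]
        | cons a m ih =>
          rw [wordProd_cons, map_mul, lift_apply_simple, Function.End.mul_apply,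
            Function.End.mul_apply]
          simp only [signedConj, ih.1, ih.2, true_and]
          rw [ih.1]
          ring
      have hs : cs.signedConj i (cs.simple i, 0) = (cs.simple i, 1) := by simp [signedConj]
      rw [hs, (hadd l _ 1).2, h0] at h1
      exact absurd h1 (by decide)
    have h2 := (cs.isRightInversion_of_mem_rightInvSeq hl' hm').2
    rw [← hw, simple_mul_simple_cancel_right] at h2
    exact lt_asymm h h2

/-- The exchange property for a left descent. -/
theorem exists_wordProd_eraseIdx_of_isLeftDescent (l : List B) {i : B}
    (h : cs.IsLeftDescent (cs.wordProd l) i) :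
    ∃ k < l.length, cs.simple i * cs.wordProd l = cs.wordProd (l.eraseIdx k) := by
  rw [← isRightDescent_inv_iff, ← wordProd_reverse] at h
  obtain ⟨k, hk, hkw⟩ := cs.exists_wordProd_eraseIdx_of_isRightDescent _ h
  rw [List.length_reverse] at hk
  refine ⟨l.length - 1 - k, by omega, ?_⟩
  have := congrArg (·⁻¹) hkw
  simp only [wordProd_reverse, mul_inv_rev, inv_inv, inv_simple] at this
  rw [this, ← wordProd_reverse]
  congr 1
  apply List.ext_getElem
  · simp [List.length_eraseIdx]; grind
  · intro n h1 h2
    grind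

/-- The alternating word of length `n` that begins with `i`. -/
def altFrom (i j : B) : ℕ → List B
  | 0 => []
  | n + 1 => i :: altFrom j i n

theorem length_altFrom (i j : B) (n : ℕ) : (altFrom i j n).length = n := by
  induction n generalizing i j with
  | zero => rfl
  | succ n ih => simp [altFrom, ih]

theorem altFrom_eq_alternatingWord (i j : B) (n : ℕ) :
    altFrom i j n = if Even n then alternatingWord i j n else alternatingWord j i n := by
  induction n generalizing i j with
  | zero => simp [altFrom, alternatingWord]
  | succ n ih =>
    rw [altFrom, ih]
    by_cases h : Even n <;> simp [h, Nat.even_add_one, alternatingWord_succ']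

theorem eraseIdx_altFrom (i j : B) (n k : ℕ) (h0 : 0 < k) (hk : k < n) :
    (altFrom i j n).eraseIdx k = altFrom i j (n - 1) ∨
      ∃ u : List B, u.length + 3 = n ∧ cs.wordProd u = cs.wordProd ((altFrom i j n).eraseIdx k) := by
  induction n generalizing i j k with
  | zero => omega
  | succ n ih =>
    obtain ⟨k, rfl⟩ := Nat.exists_eq_succ_of_ne_zero h0.ne'
    rw [altFrom, List.eraseIdx_cons_succ, Nat.add_sub_cancel]
    rcases Nat.eq_zero_or_pos k with rfl | hk0
    · obtain ⟨n, rfl⟩ := Nat.exists_eq_succ_of_ne_zero (show n ≠ 0 by omega)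
      rw [altFrom, List.eraseIdx_cons_zero]
      cases n with
      | zero => left; rfl
      | succ n =>
        right
        exact ⟨altFrom j i n, by simp [length_altFrom], by simp [altFrom, wordProd_cons]⟩
    · rcases ih j i k hk0 (by omega) with h | ⟨u, hu, hw⟩
      · left
        rw [h]
        obtain ⟨n, rfl⟩ := Nat.exists_eq_succ_of_ne_zero (show n ≠ 0 by omega)
        simp [altFrom]
      · right
        exact ⟨i :: u, by simp; omega, by rw [wordProd_cons, wordProd_cons, hw]⟩

/-- Matsumoto's theorem: a monoid-valued function on words which respects all braid relations
takes equal values on reduced words for the same element. -/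
theorem prod_map_eq_of_isReduced {G : Type*} [Monoid G] (f : B → G)
    (hf : ∀ i j n, cs.wordProd (altFrom i j n) = cs.wordProd (altFrom j i n) →
      ((altFrom i j n).map f).prod = ((altFrom j i n).map f).prod)
    {l l' : List B} (hl : cs.IsReduced l) (hl' : cs.IsReduced l')
    (h : cs.wordProd l = cs.wordProd l') : (l.map f).prod = (l'.map f).prod := by
  obtain ⟨n, hn⟩ : ∃ n, l.length = n := ⟨_, rfl⟩
  have hn' : l'.length = n := by rw [← hn, ← hl.eq, ← hl'.eq, h]
  induction n generalizing l l' with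
  | zero =>
    rw [List.length_eq_zero_iff] at hn hn'
    rw [hn, hn']
  | succ n ih =>
    have same_head : ∀ (a : B) (u u' : List B), cs.IsReduced (a :: u) → cs.IsReduced (a :: u') →
        u.length = n → u'.length = n → cs.wordProd (a :: u) = cs.wordProd (a :: u') →
        ((a :: u).map f).prod = ((a :: u').map f).prod := by
      intro a u u' hu hu' hun hun' huu
      rw [List.map_cons, List.map_cons, List.prod_cons, List.prod_cons]
      congr 1
      exact ih (hu.drop 1) (hu'.drop 1) (by simpa [wordProd_cons] using huu) hun hun'
    obtain ⟨i, a, rfl⟩ := List.exists_cons_of_length_eq_add_one hn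
    obtain ⟨j, b, rfl⟩ := List.exists_cons_of_length_eq_add_one hn'
    by_contra hne
    have hna : a.length = n := by simpa using hn
    have hnb : b.length = n := by simpa using hn'
    have hlen : cs.length (cs.wordProd (i :: a)) = n + 1 := by rw [hl.eq, hn]
    have hdi : cs.IsLeftDescent (cs.wordProd (i :: a)) i := by
      have := cs.length_wordProd_le a
      rw [IsLeftDescent, hlen, wordProd_cons, simple_mul_simple_cancel_left]; omega
    have hdj : cs.IsLeftDescent (cs.wordProd (i :: a)) j := by
      have := cs.length_wordProd_le b
      rw [IsLeftDescent, hlen, h, wordProd_cons, simple_mul_simple_cancel_left]; omega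
    have hsij : cs.simple i ≠ cs.simple j := by
      intro hs
      have hfij : f i = f j := by simpa [altFrom] using hf i j 1 (by simpa [altFrom] using hs)
      apply hne
      have hja : cs.wordProd (j :: a) = cs.wordProd (i :: a) := by
        rw [wordProd_cons, wordProd_cons, hs]
      rw [List.map_cons, List.prod_cons, hfij]
      exact same_head j a b (by rw [IsReduced, hja, hlen]; simp [hna]) hl' hna hnb (hja.trans h)
    have step : ∀ (i j : B) (a b : List B), cs.IsReduced (i :: a) → cs.IsReduced (j :: b) →
        a.length = n → b.length = n → cs.wordProd (i :: a) = cs.wordProd (j :: b) →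
        ((i :: a).map f).prod ≠ ((j :: b).map f).prod → cs.simple i ≠ cs.simple j →
        cs.IsLeftDescent (cs.wordProd (i :: a)) i →
        ∀ k, (∃ c, cs.IsReduced (altFrom j i k ++ c) ∧
          cs.wordProd (altFrom j i k ++ c) = cs.wordProd (i :: a)) →
        ∃ c, cs.IsReduced (altFrom i j (k + 1) ++ c) ∧
          cs.wordProd (altFrom i j (k + 1) ++ c) = cs.wordProd (i :: a) := by
      intro i j a b hl hl' hna hnb h hne hsij hdi k ⟨c, hc, hcw⟩
      have hlen : cs.length (cs.wordProd (i :: a)) = n + 1 := by rw [hl.eq]; simp [hna]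
      have hclen : k + c.length = n + 1 := by
        rw [← hlen, ← hcw, hc.eq, List.length_append, length_altFrom]
      rw [← hcw] at hdi
      obtain ⟨p, hp, hpw⟩ := cs.exists_wordProd_eraseIdx_of_isLeftDescent _ hdi
      have hsw : cs.length (cs.simple i * cs.wordProd (i :: a)) = n := by
        rw [cs.isLeftDescent_iff, hcw, hlen] at hdi
        omega
      rcases le_or_gt k p with hkp | hkp
      · rw [List.eraseIdx_append_of_length_le (by rwa [length_altFrom]), length_altFrom] at hpw
        rw [List.length_append, length_altFrom] at hp
        have hw : cs.wordProd (altFrom i j (k + 1) ++ c.eraseIdx (p - k)) =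
            cs.wordProd (i :: a) := by
          rw [altFrom, List.cons_append, wordProd_cons, ← hpw, simple_mul_simple_cancel_left, hcw]
        refine ⟨c.eraseIdx (p - k), ?_, hw⟩
        rw [IsReduced, hw, hlen, List.length_append, length_altFrom,
          List.length_eraseIdx_of_lt (by omega)]
        omega
      · exfalso
        rw [List.eraseIdx_append_of_lt_length (by rwa [length_altFrom])] at hpw
        obtain ⟨k, rfl⟩ := Nat.exists_eq_succ_of_ne_zero (show k ≠ 0 by omega)
        rcases Nat.eq_zero_or_pos p with rfl | hp0
        · apply hsij
          rw [altFrom, List.eraseIdx_cons_zero, List.cons_append, wordProd_cons] at hpw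
          have : cs.simple i * cs.simple j = 1 := by
            rw [← mul_assoc] at hpw
            exact mul_eq_right.1 hpw
          rw [mul_eq_one_iff_eq_inv.1 this, inv_simple]
        · rcases cs.eraseIdx_altFrom j i _ p hp0 hkp with he | ⟨u, hu, huw⟩
          · rw [he, Nat.succ_sub_one] at hpw
            have hw : cs.wordProd (altFrom i j (k + 1) ++ c) = cs.wordProd (i :: a) := by
              rw [altFrom, List.cons_append, wordProd_cons, ← hpw, simple_mul_simple_cancel_left,
                hcw]
            have halt : cs.wordProd (altFrom i j (k + 1)) = cs.wordProd (altFrom j i (k + 1)) := by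
              have := hw.trans hcw.symm
              rwa [wordProd_append, wordProd_append, mul_left_inj] at this
            have hfa := hf i j _ halt
            apply hne
            have hir : cs.IsReduced (altFrom i j (k + 1) ++ c) := by
              rw [IsReduced, hw, hlen, List.length_append, length_altFrom]; omega
            have h1 := same_head i a (altFrom j i k ++ c) hl hir hna
              (by rw [List.length_append, length_altFrom]; omega) hw.symm
            have h2 := same_head j b (altFrom i j k ++ c) hl' hc hnb
              (by rw [List.length_append, length_altFrom]; omega) (h.symm.trans hcw.symm)
            rw [h1, h2]
            change ((altFrom i j (k + 1) ++ c).map f).prod = ((altFrom j i (k + 1) ++ c).map f).prod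
            rw [List.map_append, List.map_append, List.prod_append, List.prod_append, hfa]
          · have := cs.length_wordProd_le (u ++ c)
            rw [wordProd_append, huw, ← wordProd_append, ← hpw, hcw, hsw, List.length_append] at this
            omega
    have all : ∀ k, (∃ c, cs.IsReduced (altFrom i j k ++ c) ∧
          cs.wordProd (altFrom i j k ++ c) = cs.wordProd (i :: a)) ∧
        (∃ c, cs.IsReduced (altFrom j i k ++ c) ∧
          cs.wordProd (altFrom j i k ++ c) = cs.wordProd (i :: a)) := by
      intro k
      induction k with
      | zero => exact ⟨⟨i :: a, hl, rfl⟩, ⟨i :: a, hl, rfl⟩⟩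
      | succ k ihk =>
        refine ⟨step i j a b hl hl' hna hnb h hne hsij hdi k ihk.2, ?_⟩
        rw [h] at ihk hdj ⊢
        exact step j i b a hl' hl hnb hna h.symm (Ne.symm hne) hsij.symm hdj k ihk.1
    obtain ⟨⟨c, hc, hcw⟩, -⟩ := all (n + 2)
    have := hc.eq
    rw [hcw, hlen, List.length_append, length_altFrom] at this
    omega

end CoxeterSystem

end Coxeter

section Quasiparabolic

open CoxeterSystem

variable {cs : CoxeterSystem M W} {σ : W → X → X} {ht : X → ℚ}

theorem IsActionOf.inv_apply (hact : IsActionOf σ) (w : W) (x : X) : σ w⁻¹ (σ w x) = x := by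
  rw [← hact.2, inv_mul_cancel, hact.1]

theorem IsActionOf.simple_simple (hact : IsActionOf σ) (i : B) (x : X) :
    σ (cs.simple i) (σ (cs.simple i) x) = x := by
  rw [← hact.2, simple_mul_simple_self, hact.1]

theorem IsActionOf.wordProd_cons (hact : IsActionOf σ) (i : B) (l : List B) (x : X) :
    σ (cs.wordProd (i :: l)) x = σ (cs.simple i) (σ (cs.wordProd l) x) := by
  rw [CoxeterSystem.wordProd_cons, hact.2]

theorem IsScaled.simple_le (hsc : IsScaled cs σ ht) (i : B) (x : X) :
    ht (σ (cs.simple i) x) ≤ ht x + 1 := by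
  have h := hsc i x
  simp only [Set.mem_insert_iff, Set.mem_singleton_iff] at h
  rcases h with h | h | h <;> linarith

theorem IsScaled.wordProd_le (hact : IsActionOf σ) (hsc : IsScaled cs σ ht) (l : List B) (x : X) :
    ht (σ (cs.wordProd l) x) ≤ ht x + l.length := by
  induction l with
  | nil => simp [hact.1]
  | cons i l ih =>
    have := hsc.simple_le i (σ (cs.wordProd l) x)
    rw [hact.wordProd_cons, List.length_cons]
    push_cast
    linarith

/-- If `i :: l` raises the height of `x` maximally, then so does `l`. -/
theorem IsScaled.ascending_tail (hact : IsActionOf σ) (hsc : IsScaled cs σ ht) {i : B} {l : List B}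
    {x : X} (h : ht (σ (cs.wordProd (i :: l)) x) = ht x + (i :: l).length) :
    ht (σ (cs.wordProd l) x) = ht x + l.length := by
  have h1 := hsc.wordProd_le hact l x
  have h2 := hsc.simple_le i (σ (cs.wordProd l) x)
  rw [hact.wordProd_cons, List.length_cons] at h
  push_cast at h
  linarith

theorem IsQP.simple_fixed (hqp : IsQP cs σ ht) {i : B} {x : X}
    (h : ht (σ (cs.simple i) x) = ht x) : σ (cs.simple i) x = x :=
  hqp.2.1 _ (cs.isReflection_simple i) x h

/-- The strong exchange property for quasiparabolic sets. -/
theorem IsQP.exists_eraseIdx (hact : IsActionOf σ) (hqp : IsQP cs σ ht) {x₀ : X} (l : List B) (r : W)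
    (hr : cs.IsReflection r) (hasc : ht (σ (cs.wordProd l) x₀) = ht x₀ + l.length)
    (hlt : ht (σ r (σ (cs.wordProd l) x₀)) < ht (σ (cs.wordProd l) x₀))
    (hmin : ht x₀ ≤ ht (σ ((cs.wordProd l)⁻¹ * r * cs.wordProd l) x₀)) :
    ∃ k < l.length, σ r (σ (cs.wordProd l) x₀) = σ (cs.wordProd (l.eraseIdx k)) x₀ := by
  induction l generalizing r with
  | nil =>
    simp [hact.1] at hlt hmin
    linarith
  | cons i l ih =>
    have hasc' := hqp.1.ascending_tail hact hasc
    rw [hact.wordProd_cons] at hasc hlt ⊢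
    set x' := σ (cs.wordProd l) x₀ with hx'
    by_cases heq : σ r (σ (cs.simple i) x') = x'
    · exact ⟨0, by simp, by simpa using heq⟩
    have hrr : σ r (σ r (σ (cs.simple i) x')) = σ (cs.simple i) x' := by
      rw [← hact.2, hr.mul_self, hact.1]
    have hr' : σ (cs.simple i * r * (cs.simple i)⁻¹) x' =
        σ (cs.simple i) (σ r (σ (cs.simple i) x')) := by
      rw [hact.2, hact.2, inv_simple]
    have hle : ht (σ (cs.simple i * r * (cs.simple i)⁻¹) x') ≤ ht x' := by
      by_contra! hgt
      apply heq
      have h2 := hqp.2.2 r hr (σ r (σ (cs.simple i) x')) i (by rwa [hrr])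
        (by rwa [hrr, hact.simple_simple, ← hr'])
      rw [hrr] at h2
      have := congrArg (σ (cs.simple i)) h2
      rw [hact.simple_simple, hact.simple_simple] at this
      exact this.symm
    rcases hle.lt_or_eq with hlt' | heq'
    · obtain ⟨k, hk, hkw⟩ := ih (cs.simple i * r * (cs.simple i)⁻¹) (hr.conj _) hasc' hlt' (by
        rw [CoxeterSystem.wordProd_cons] at hmin
        convert hmin using 3
        simp [mul_assoc])
      refine ⟨k + 1, by simpa using hk, ?_⟩
      rw [List.eraseIdx_cons_succ, hact.wordProd_cons, ← hkw, hr', hact.simple_simple]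
    · have hfix := hqp.2.1 _ (hr.conj _) x' heq'
      rw [hr'] at hfix
      have := congrArg (σ (cs.simple i)) hfix
      rw [hact.simple_simple] at this
      rw [this] at hlt
      exact absurd hlt (lt_irrefl _)

/-- If `x₀` has minimal height in its orbit under the parabolic subgroup of type `J`, then
each element of this orbit is reached from `x₀` by a word which raises the height in each step. -/
theorem IsQP.exists_ascending (hact : IsActionOf σ) (hqp : IsQP cs σ ht) {x₀ : X} (J : Set B)
    (hmin : ∀ l : List B, (∀ b ∈ l, b ∈ J) → ht x₀ ≤ ht (σ (cs.wordProd l) x₀))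
    (l : List B) (hl : ∀ b ∈ l, b ∈ J) :
    ∃ l' : List B, (∀ b ∈ l', b ∈ J) ∧ σ (cs.wordProd l') x₀ = σ (cs.wordProd l) x₀ ∧
      ht (σ (cs.wordProd l') x₀) = ht x₀ + l'.length := by
  induction l with
  | nil => exact ⟨[], by simp, rfl, by simp [hact.1]⟩
  | cons i l ih =>
    have hi : i ∈ J := hl i (by simp)
    obtain ⟨l', hl', hw, hasc⟩ := ih fun b hb => hl b (by simp [hb])
    rw [hact.wordProd_cons, ← hw]
    have h := hqp.1 i (σ (cs.wordProd l') x₀)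
    simp only [Set.mem_insert_iff, Set.mem_singleton_iff] at h
    rcases h with h | h | h
    · obtain ⟨k, hk, hkw⟩ := hqp.exists_eraseIdx hact l' _ (cs.isReflection_simple i) hasc
        (by linarith) (by
          have := hmin (l'.reverse ++ i :: l') (by
            intro b hb
            simp only [List.mem_append, List.mem_reverse, List.mem_cons] at hb
            rcases hb with hb | rfl | hb
            exacts [hl' b hb, hi, hl' b hb])
          rwa [wordProd_append, wordProd_reverse, CoxeterSystem.wordProd_cons,
            ← mul_assoc] at this)
      refine ⟨l'.eraseIdx k, fun b hb => hl' b (List.mem_of_mem_eraseIdx hb), hkw.symm, ?_⟩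
      rw [← hkw, List.length_eraseIdx_of_lt hk, Nat.cast_sub (by omega)]
      push_cast
      linarith
    · exact ⟨l', hl', (hqp.simple_fixed (by linarith)).symm, hasc⟩
    · refine ⟨i :: l', by simpa [hi] using hl', hact.wordProd_cons _ _ _, ?_⟩
      rw [hact.wordProd_cons, List.length_cons]
      push_cast
      linarith

/-- An element of minimal height is the only `W`-minimal element of its orbit. -/
theorem IsQP.eq_of_wMin (hact : IsActionOf σ) (hqp : IsQP cs σ ht) {x₀ x : X}
    (hmin : ∀ w, ht x₀ ≤ ht (σ w x₀)) (hx : WMin cs σ ht x) (h : ∃ w, x = σ w x₀) : x = x₀ := by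
  obtain ⟨w, rfl⟩ := h
  obtain ⟨l, rfl⟩ := cs.wordProd_surjective w
  obtain ⟨l', -, hw, hasc⟩ := hqp.exists_ascending hact Set.univ (fun l _ => hmin _) l (by simp)
  rw [← hw] at hx ⊢
  cases l' with
  | nil => simp [hact.1]
  | cons i l' =>
    have h1 := hqp.1.ascending_tail hact hasc
    have h2 := hx i
    rw [hasc, hact.wordProd_cons, hact.simple_simple, h1, List.length_cons] at h2
    push_cast at h2
    linarith

/-- The point `m` has minimal height in its orbit under the dihedral subgroup generated by the
simple reflections `s` and `t`, for a quasiparabolic action. -/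
structure IsDihedralMin (cs : CoxeterSystem M W) (σ : W → X → X) (ht : X → ℚ) (s t : B) (m : X) :
    Prop where
  act : IsActionOf σ
  qp : IsQP cs σ ht
  min : ∀ l : List B, (∀ b ∈ l, b = s ∨ b = t) → ht m ≤ ht (σ (cs.wordProd l) m)

theorem IsDihedralMin.symm {s t : B} {m : X} (h : IsDihedralMin cs σ ht s t m) :
    IsDihedralMin cs σ ht t s m :=
  ⟨h.act, h.qp, fun l hl => h.min l fun b hb => (hl b hb).symm⟩

/-- The image of `m` under the alternating word of length `n` whose first applied letter is `s`. -/
def altPt (cs : CoxeterSystem M W) (σ : W → X → X) (m : X) (s t : B) (n : ℕ) : X :=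
  σ (cs.wordProd (alternatingWord t s n)) m

theorem mem_alternatingWord {s t b : B} {n : ℕ} (h : b ∈ alternatingWord t s n) :
    b = s ∨ b = t := by
  induction n generalizing s t with
  | zero => simp [alternatingWord] at h
  | succ n ih =>
    rw [alternatingWord_succ', List.mem_cons] at h
    rcases h with rfl | h
    · split_ifs <;> simp
    · exact ih h

theorem alternatingWord_add (i j : B) (n k : ℕ) :
    alternatingWord i j (n + k) =
      (if Even n then alternatingWord i j k else alternatingWord j i k) ++ alternatingWord i j n := by
  induction n generalizing i j with
  | zero => simp [alternatingWord]
  | succ n ih =>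
    rw [Nat.add_right_comm, alternatingWord_succ, ih, alternatingWord_succ]
    by_cases h : Even n <;> simp [h, Nat.even_add_one]

namespace IsDihedralMin

variable {s t : B} {m : X}

theorem altPt_zero (h : IsDihedralMin cs σ ht s t m) : altPt cs σ m s t 0 = m := by
  simp [altPt, alternatingWord, h.act.1]

theorem altPt_succ (h : IsDihedralMin cs σ ht s t m) (n : ℕ) :
    altPt cs σ m s t (n + 1) =
      σ (cs.simple (if Even n then s else t)) (altPt cs σ m s t n) := by
  rw [altPt, alternatingWord_succ', h.act.wordProd_cons]
  rfl

theorem simple_altPt_succ (h : IsDihedralMin cs σ ht s t m) (n : ℕ) :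
    σ (cs.simple (if Even n then s else t)) (altPt cs σ m s t (n + 1)) = altPt cs σ m s t n := by
  rw [h.altPt_succ, h.act.simple_simple]

theorem altPt_le (h : IsDihedralMin cs σ ht s t m) (n : ℕ) :
    ht (altPt cs σ m s t n) ≤ ht m + n := by
  simpa [altPt] using h.qp.1.wordProd_le h.act (alternatingWord t s n) m

theorem le_altPt (h : IsDihedralMin cs σ ht s t m) (n : ℕ) : ht m ≤ ht (altPt cs σ m s t n) :=
  h.min _ fun _ hb => mem_alternatingWord hb

theorem ascending_of_succ (h : IsDihedralMin cs σ ht s t m) {n : ℕ}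
    (hn : ht (altPt cs σ m s t (n + 1)) = ht m + (n + 1 : ℕ)) :
    ht (altPt cs σ m s t n) = ht m + n := by
  have h1 := h.altPt_le n
  have h2 := h.qp.1.simple_le (if Even n then s else t) (altPt cs σ m s t n)
  rw [← h.altPt_succ, hn] at h2
  push_cast at h2
  linarith

theorem ascending_of_le (h : IsDihedralMin cs σ ht s t m) {n k : ℕ} (hkn : k ≤ n)
    (hn : ht (altPt cs σ m s t n) = ht m + n) : ht (altPt cs σ m s t k) = ht m + k := by
  induction hkn with
  | refl => exact hn
  | step _ ih => exact ih (h.ascending_of_succ hn)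

/-- Words in `s` and `t` which raise the height of `m` in each step are alternating. -/
theorem eq_altPt_of_ascending (h : IsDihedralMin cs σ ht s t m) (l : List B)
    (hl : ∀ b ∈ l, b = s ∨ b = t) (hasc : ht (σ (cs.wordProd l) m) = ht m + l.length) :
    σ (cs.wordProd l) m = altPt cs σ m s t l.length ∨
      σ (cs.wordProd l) m = altPt cs σ m t s l.length := by
  induction l with
  | nil => left; simp [h.altPt_zero, h.act.1]
  | cons a l ih =>
    have hasc' := h.qp.1.ascending_tail h.act hasc
    have aux : ∀ s t : B, IsDihedralMin cs σ ht s t m → (a = s ∨ a = t) →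
        σ (cs.wordProd l) m = altPt cs σ m s t l.length →
        σ (cs.wordProd (a :: l)) m = altPt cs σ m s t (l.length + 1) ∨
          σ (cs.wordProd (a :: l)) m = altPt cs σ m t s (l.length + 1) := by
      intro s t h ha hp
      rw [h.act.wordProd_cons] at hasc ⊢
      by_cases hc : a = if Even l.length then s else t
      · left
        rw [h.altPt_succ, hp, hc]
      · right
        rcases Nat.eq_zero_or_pos l.length with h0 | h0
        · rw [h0] at hc hp ⊢
          have hat : a = t := by simpa [show ¬ a = s by simpa using hc] using ha
          rw [h.symm.altPt_succ, hp, h.altPt_zero, h.symm.altPt_zero, hat]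
          simp
        · exfalso
          obtain ⟨n, hn⟩ := Nat.exists_eq_succ_of_ne_zero h0.ne'
          have hc' : a = if Even n then s else t := by
            rw [hn, Nat.succ_eq_add_one] at hc
            by_cases hev : Even n <;> simp [hev, Nat.even_add_one] at hc ⊢ <;> tauto
          have hle := h.altPt_le n
          rw [hp, hn, hc', Nat.succ_eq_add_one, h.simple_altPt_succ, List.length_cons, hn] at hasc
          push_cast at hasc
          linarith
    rw [List.length_cons]
    rcases ih (fun b hb => hl b (by simp [hb])) hasc' with hp | hp
    · exact aux s t h (hl a (by simp)) hp
    · exact (aux t s h.symm (hl a (by simp)).symm hp).symm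

/-- Where the alternating path from `m` stops ascending, it either stays constant or it
meets the other alternating path. -/
theorem top (h : IsDihedralMin cs σ ht s t m) {k : ℕ}
    (hk : ht (altPt cs σ m s t k) = ht m + k)
    (hk' : ht (altPt cs σ m s t (k + 1)) ≠ ht m + (k + 1 : ℕ)) :
    altPt cs σ m s t (k + 1) = altPt cs σ m s t k ∨
      1 ≤ k ∧ altPt cs σ m s t k = altPt cs σ m t s k := by
  have hsc := h.qp.1 (if Even k then s else t) (altPt cs σ m s t k)
  rw [← h.altPt_succ] at hsc
  simp only [Set.mem_insert_iff, Set.mem_singleton_iff] at hsc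
  rcases hsc with hd | hd | hd
  · right
    have hmin := h.le_altPt (k + 1)
    have hk0 : 1 ≤ k := by
      by_contra! hk0
      obtain rfl : k = 0 := by omega
      push_cast at hk
      linarith
    refine ⟨hk0, ?_⟩
    obtain ⟨k, rfl⟩ := Nat.exists_eq_succ_of_ne_zero (show k ≠ 0 by omega)
    rw [Nat.succ_eq_add_one] at *
    obtain ⟨l, hl, hw, hasc⟩ := h.qp.exists_ascending h.act {b | b = s ∨ b = t} h.min
      (alternatingWord t s (k + 1 + 1)) (fun b hb => mem_alternatingWord hb)
    change _ = altPt cs σ m s t (k + 1 + 1) at hw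
    have hlen : l.length = k := by
      rw [hw] at hasc
      have : (l.length : ℚ) = k := by push_cast at hk; linarith
      exact_mod_cast this
    have hback := h.simple_altPt_succ (k + 1)
    have hcases := h.eq_altPt_of_ascending l hl hasc
    rw [hw, hlen] at hcases
    rcases hcases with hc | hc
    · rw [hc] at hback
      rcases Nat.eq_zero_or_pos k with rfl | hk1
      · rw [h.symm.altPt_succ, ← hback, h.altPt_zero, h.symm.altPt_zero]
        simp
      · exfalso
        obtain ⟨k, rfl⟩ := Nat.exists_eq_succ_of_ne_zero hk1.ne'
        have h2 := h.simple_altPt_succ k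
        rw [show (if Even k then s else t) = if Even (k + 1 + 1) then s else t by
          simp [Nat.even_add_one]] at h2
        rw [Nat.succ_eq_add_one, h2] at hback
        have := h.altPt_le k
        rw [hback, hk] at this
        push_cast at this
        linarith
    · rw [hc] at hback
      rw [h.symm.altPt_succ k, ← hback]
      congr 2
      by_cases hev : Even k <;> simp [hev, Nat.even_add_one]
  · left
    rw [h.altPt_succ]
    apply h.qp.simple_fixed
    rw [← h.altPt_succ]
    linarith
  · exfalso
    apply hk'
    push_cast
    linarith

/-- If the alternating path from `m` stays constant after `k` steps, it then runs backwards. -/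
theorem altPt_fold (h : IsDihedralMin cs σ ht s t m) {k : ℕ}
    (hk : altPt cs σ m s t (k + 1) = altPt cs σ m s t k) {i : ℕ} (hi : i ≤ k) :
    altPt cs σ m s t (k + 1 + i) = altPt cs σ m s t (k - i) := by
  induction i with
  | zero => simpa using hk
  | succ i ih =>
    obtain ⟨j, rfl⟩ : ∃ j, k = j + 1 + i := ⟨k - 1 - i, by omega⟩
    rw [← add_assoc, h.altPt_succ, ih (by omega), show j + 1 + i - i = j + 1 by omega,
      show j + 1 + i - (i + 1) = j by omega, ← h.simple_altPt_succ j]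
    congr 3
    rw [show j + 1 + i + 1 + i = j + 2 * (i + 1) by ring]
    simp [Nat.even_add]

/-- If the alternating path from `m` stays constant after `k` steps, it continues with the
other alternating path once it has returned to `m`. -/
theorem altPt_return (h : IsDihedralMin cs σ ht s t m) {k : ℕ}
    (hk : altPt cs σ m s t (k + 1) = altPt cs σ m s t k) (i : ℕ) :
    altPt cs σ m s t (2 * k + 1 + i) = altPt cs σ m t s i := by
  induction i with
  | zero =>
    rw [show 2 * k + 1 + 0 = k + 1 + k by ring, h.altPt_fold hk le_rfl, Nat.sub_self,
      h.altPt_zero, h.symm.altPt_zero]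
  | succ i ih =>
    rw [← add_assoc, h.altPt_succ, ih, h.symm.altPt_succ]
    congr 2
    by_cases hev : Even i <;> simp [hev, Nat.even_add]

theorem isReflection_alternatingWord_mul_inv (cs : CoxeterSystem M W) (s t : B) (n : ℕ) :
    cs.IsReflection (cs.wordProd (alternatingWord t s n) *
      (cs.wordProd (alternatingWord s t n))⁻¹ * cs.simple (if Even n then t else s)) := by
  induction n with
  | zero => simpa [alternatingWord] using cs.isReflection_simple t
  | succ n ih =>
    have := ih.conj (cs.simple (if Even n then s else t))
    rw [alternatingWord_succ', alternatingWord_succ', CoxeterSystem.wordProd_cons,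
      CoxeterSystem.wordProd_cons]
    convert this using 1
    by_cases hev : Even n <;> simp [hev, Nat.even_add_one, mul_assoc]

/-- The two alternating paths from `m` cannot both stay constant at a positive height
before they have met. -/
theorem altPt_eq_of_fixed (h : IsDihedralMin cs σ ht s t m) {k k' : ℕ} (hkk' : k' ≤ k)
    (hk : ht (altPt cs σ m s t k) = ht m + k) (hk' : ht (altPt cs σ m t s k') = ht m + k')
    (hfix : altPt cs σ m t s (k' + 1) = altPt cs σ m t s k') :
    altPt cs σ m s t k' = altPt cs σ m t s k' := by
  have hr := isReflection_alternatingWord_mul_inv cs s t k'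
  have hmap : σ (cs.wordProd (alternatingWord t s k') *
      (cs.wordProd (alternatingWord s t k'))⁻¹ * cs.simple (if Even k' then t else s))
      (altPt cs σ m t s k') = altPt cs σ m s t k' := by
    rw [h.act.2, ← h.symm.altPt_succ, hfix, h.act.2, altPt, altPt, h.act.inv_apply]
  have := h.qp.2.1 _ hr (altPt cs σ m t s k') (by
    rw [hmap, hk', h.ascending_of_le hkk' hk])
  rwa [hmap] at this

end IsDihedralMin

end Quasiparabolic

section Module

open CoxeterSystem

/-- The common form of the operators `T_s` and `U_s`: the standard basis elements indexed by
fixed points are scaled by `q`. -/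
def Tq (cs : CoxeterSystem M W) (σ : W → X → X) (ht : X → ℚ) (q : A) (i : B) :
    Module.End A (X →₀ A) :=
  Finsupp.lift (X →₀ A) A X fun x =>
    if ht x < ht (σ (cs.simple i) x) then Mstd (σ (cs.simple i) x)
    else if ht (σ (cs.simple i) x) < ht x then Mstd (σ (cs.simple i) x) + (v - vinv) • Mstd x
    else q • Mstd x

/-- The operator `Tq + (v⁻¹ - v)`. -/
def TqBar (cs : CoxeterSystem M W) (σ : W → X → X) (ht : X → ℚ) (q : A) (i : B) :
    Module.End A (X →₀ A) :=
  Tq cs σ ht q i + (vinv - v) • (LinearMap.id : (X →₀ A) →ₗ[A] (X →₀ A))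

variable {cs : CoxeterSystem M W} {σ : W → X → X} {ht : X → ℚ} {q : A}

theorem Tq_of_lt {i : B} {x : X} (h : ht x < ht (σ (cs.simple i) x)) :
    Tq cs σ ht q i (Mstd x) = Mstd (σ (cs.simple i) x) := by
  simp [Tq, Mstd, h]

theorem Tq_of_gt {i : B} {x : X} (h : ht (σ (cs.simple i) x) < ht x) :
    Tq cs σ ht q i (Mstd x) = Mstd (σ (cs.simple i) x) + (v - vinv) • Mstd x := by
  simp [Tq, Mstd, h, h.le.not_gt]

theorem Tq_of_eq {i : B} {x : X} (h : ht (σ (cs.simple i) x) = ht x) :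
    Tq cs σ ht q i (Mstd x) = q • Mstd x := by
  simp only [Tq, Mstd, Finsupp.lift_apply, h, lt_irrefl, if_false, zero_smul,
    Finsupp.sum_single_index, one_smul]

theorem TqBar_apply (i : B) (m : X →₀ A) :
    TqBar cs σ ht q i m = Tq cs σ ht q i m + (vinv - v) • m := rfl

theorem end_ext_Mstd {f g : Module.End A (X →₀ A)} (h : ∀ x, f (Mstd x) = g (Mstd x)) : f = g :=
  Finsupp.lhom_ext' fun x => LinearMap.ext_ring (h x)

theorem Tq_Tq_apply (hact : IsActionOf σ) (hq : q * (q + vinv - v) = 1) (i : B) (m : X →₀ A) :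
    Tq cs σ ht q i (Tq cs σ ht q i m) = m + (v - vinv) • Tq cs σ ht q i m := by
  suffices Tq cs σ ht q i * Tq cs σ ht q i = 1 + (v - vinv) • Tq cs σ ht q i from
    LinearMap.congr_fun this m
  refine end_ext_Mstd fun x => ?_
  have hss := hact.simple_simple (cs := cs) i x
  simp only [Module.End.mul_apply, LinearMap.add_apply, Module.End.one_apply, LinearMap.smul_apply]
  rcases lt_trichotomy (ht x) (ht (σ (cs.simple i) x)) with h | h | h
  · rw [Tq_of_lt h, Tq_of_gt (by rwa [hss]), hss]
  · rw [Tq_of_eq h.symm, map_smul, Tq_of_eq h.symm, smul_smul, smul_smul,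
      show q * q = 1 + (v - vinv) * q by linear_combination hq, add_smul, one_smul]
  · rw [Tq_of_gt h, map_add, map_smul, Tq_of_gt h, Tq_of_lt (by rwa [hss]), hss]

theorem Tq_TqBar_apply (hact : IsActionOf σ) (hq : q * (q + vinv - v) = 1) (i : B) (m : X →₀ A) :
    Tq cs σ ht q i (TqBar cs σ ht q i m) = m := by
  rw [TqBar_apply, map_add, map_smul, Tq_Tq_apply hact hq]
  module

theorem TqBar_Tq_apply (hact : IsActionOf σ) (hq : q * (q + vinv - v) = 1) (i : B) (m : X →₀ A) :
    TqBar cs σ ht q i (Tq cs σ ht q i m) = m := by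
  rw [TqBar_apply, Tq_Tq_apply hact hq]
  module

theorem TqBar_TqBar_apply (hact : IsActionOf σ) (hq : q * (q + vinv - v) = 1) (i : B)
    (m : X →₀ A) :
    TqBar cs σ ht q i (TqBar cs σ ht q i m) = m + (vinv - v) • TqBar cs σ ht q i m := by
  rw [TqBar_apply i (TqBar cs σ ht q i m), Tq_TqBar_apply hact hq]

theorem TqBar_of_eq {i : B} {x : X} (h : ht (σ (cs.simple i) x) = ht x) :
    TqBar cs σ ht q i (Mstd x) = (q + vinv - v) • Mstd x := by
  rw [TqBar_apply, Tq_of_eq h]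
  module

theorem prod_map_Tq_of_ascending (hact : IsActionOf σ) (hsc : IsScaled cs σ ht) (l : List B) (x : X)
    (hasc : ht (σ (cs.wordProd l) x) = ht x + l.length) :
    (l.map (Tq cs σ ht q)).prod (Mstd x) = Mstd (σ (cs.wordProd l) x) := by
  induction l with
  | nil => simp [hact.1]
  | cons i l ih =>
    have h := hsc.ascending_tail hact hasc
    rw [List.map_cons, List.prod_cons, Module.End.mul_apply, ih h, hact.wordProd_cons]
    apply Tq_of_lt
    rw [← hact.wordProd_cons, h, hasc]
    simp

/-- The analogue of `altPt` in the module. -/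
def altVec (cs : CoxeterSystem M W) (σ : W → X → X) (ht : X → ℚ) (q : A) (m : X) (s t : B)
    (n : ℕ) : X →₀ A :=
  ((alternatingWord t s n).map (Tq cs σ ht q)).prod (Mstd m)

/-- If the alternating words of length `n` act equally on `y`, then also on `s • y`. -/
theorem altPt_simple_eq (hact : IsActionOf σ) {s t : B} {n : ℕ} {y : X}
    (h : altPt cs σ y s t n = altPt cs σ y t s n) :
    altPt cs σ (σ (cs.simple s) y) s t n = altPt cs σ (σ (cs.simple s) y) t s n := by
  cases n with
  | zero => rfl
  | succ n =>
    have hP : ∀ y, altPt cs σ y s t (n + 1) = altPt cs σ (σ (cs.simple s) y) t s n := fun y => by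
      rw [altPt, alternatingWord_succ, List.concat_eq_append, wordProd_append, hact.2]; simp [altPt]
    have hQ : ∀ y, altPt cs σ y t s (n + 1) =
        σ (cs.simple (if Even n then t else s)) (altPt cs σ y t s n) := fun y => by
      rw [altPt, alternatingWord_succ', hact.wordProd_cons, altPt]
    rw [hQ, ← hP, h, hQ, hP, hact.simple_simple, hact.simple_simple]

theorem altPt_wordProd_eq (hact : IsActionOf σ) {s t : B} {n : ℕ} {y : X}
    (h : altPt cs σ y s t n = altPt cs σ y t s n) (l : List B) (hl : ∀ b ∈ l, b = s ∨ b = t) :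
    altPt cs σ (σ (cs.wordProd l) y) s t n = altPt cs σ (σ (cs.wordProd l) y) t s n := by
  induction l with
  | nil => simpa [hact.1] using h
  | cons i l ih =>
    have := ih fun b hb => hl b (by simp [hb])
    rw [hact.wordProd_cons]
    rcases hl i (by simp) with rfl | rfl
    · exact altPt_simple_eq hact this
    · exact (altPt_simple_eq hact this.symm).symm

/-- If the products of operators along alternating words of length `n` agree at `y`,
then also at `T_s y`. -/
theorem prod_alternatingWord_Tq_eq (hact : IsActionOf σ) (hq : q * (q + vinv - v) = 1) {s t : B}
    {n : ℕ} {y : X →₀ A}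
    (h : ((alternatingWord t s n).map (Tq cs σ ht q)).prod y =
      ((alternatingWord s t n).map (Tq cs σ ht q)).prod y) :
    ((alternatingWord t s n).map (Tq cs σ ht q)).prod (Tq cs σ ht q s y) =
      ((alternatingWord s t n).map (Tq cs σ ht q)).prod (Tq cs σ ht q s y) := by
  cases n with
  | zero => rfl
  | succ n =>
    have hP : ∀ y, ((alternatingWord t s (n + 1)).map (Tq cs σ ht q)).prod y =
        ((alternatingWord s t n).map (Tq cs σ ht q)).prod (Tq cs σ ht q s y) := fun y => by
      rw [alternatingWord_succ]; simp
    have hQ : ∀ y, ((alternatingWord s t (n + 1)).map (Tq cs σ ht q)).prod y =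
        Tq cs σ ht q (if Even n then t else s)
          (((alternatingWord s t n).map (Tq cs σ ht q)).prod y) := fun y => by
      rw [alternatingWord_succ', List.map_cons, List.prod_cons, Module.End.mul_apply]
    rw [hQ, ← hP y, h, hQ, hP, Tq_Tq_apply hact hq, Tq_Tq_apply hact hq, map_add, map_smul, ← hP,
      h, hQ]

theorem prod_alternatingWord_Tq_eq_word (hact : IsActionOf σ) (hq : q * (q + vinv - v) = 1)
    {s t : B} {n : ℕ} {y : X →₀ A}
    (h : ((alternatingWord t s n).map (Tq cs σ ht q)).prod y =
      ((alternatingWord s t n).map (Tq cs σ ht q)).prod y)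
    (l : List B) (hl : ∀ b ∈ l, b = s ∨ b = t) :
    ((alternatingWord t s n).map (Tq cs σ ht q)).prod ((l.map (Tq cs σ ht q)).prod y) =
      ((alternatingWord s t n).map (Tq cs σ ht q)).prod ((l.map (Tq cs σ ht q)).prod y) := by
  induction l with
  | nil => simpa using h
  | cons i l ih =>
    have := ih fun b hb => hl b (by simp [hb])
    rw [List.map_cons, List.prod_cons, Module.End.mul_apply]
    rcases hl i (by simp) with rfl | rfl
    · exact prod_alternatingWord_Tq_eq hact hq this
    · exact (prod_alternatingWord_Tq_eq hact hq this.symm).symm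

namespace IsDihedralMin

variable {s t : B} {m : X}

theorem altVec_of_ascending (h : IsDihedralMin cs σ ht s t m) {n : ℕ}
    (hn : ht (altPt cs σ m s t n) = ht m + n) :
    altVec cs σ ht q m s t n = Mstd (altPt cs σ m s t n) :=
  prod_map_Tq_of_ascending h.act h.qp.1 _ _ (by simpa [altPt] using hn)

theorem altVec_succ_of_fixed (h : IsDihedralMin cs σ ht s t m) {k : ℕ}
    (hk : ht (altPt cs σ m s t k) = ht m + k)
    (hfix : altPt cs σ m s t (k + 1) = altPt cs σ m s t k) :
    altVec cs σ ht q m s t (k + 1) = q • Mstd (altPt cs σ m s t k) := by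
  have := h.altVec_of_ascending (q := q) hk
  rw [altVec, alternatingWord_succ', List.map_cons, List.prod_cons, Module.End.mul_apply]
  rw [altVec] at this
  rw [this]
  apply Tq_of_eq
  rw [← h.altPt_succ, hfix]

theorem exists_fixed (h : IsDihedralMin cs σ ht s t m) {j : ℕ}
    (hmin : ∀ i, 1 ≤ i → i < j → altPt cs σ m s t i ≠ altPt cs σ m t s i)
    (hj : ht (altPt cs σ m s t j) ≠ ht m + j) :
    ∃ k < j, ht (altPt cs σ m s t k) = ht m + k ∧
      altPt cs σ m s t (k + 1) = altPt cs σ m s t k := by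
  induction j with
  | zero => simp [h.altPt_zero] at hj
  | succ j ih =>
    by_cases hj' : ht (altPt cs σ m s t j) = ht m + j
    · refine ⟨j, by omega, hj', (h.top hj' hj).resolve_right fun ⟨h1, h2⟩ => ?_⟩
      exact hmin j h1 (by omega) h2
    · obtain ⟨k, hk, hk'⟩ := ih (fun i h1 h2 => hmin i h1 (by omega)) hj'
      exact ⟨k, by omega, hk'⟩

theorem altVec_eq_of_first_meet (h : IsDihedralMin cs σ ht s t m) {j : ℕ}
    (hj : altPt cs σ m s t j = altPt cs σ m t s j)
    (hmin : ∀ i, 1 ≤ i → i < j → altPt cs σ m s t i ≠ altPt cs σ m t s i) :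
    altVec cs σ ht q m s t j = altVec cs σ ht q m t s j := by
  by_cases ha : ht (altPt cs σ m s t j) = ht m + j
  · rw [h.altVec_of_ascending ha, h.symm.altVec_of_ascending (by rwa [← hj]), hj]
  obtain ⟨k, hkj, hk, hkf⟩ := h.exists_fixed hmin ha
  obtain ⟨k', hkj', hk', hkf'⟩ := h.symm.exists_fixed (fun i h1 h2 => (hmin i h1 h2).symm)
    (by rwa [← hj])
  clear ha
  wlog hle : k' ≤ k generalizing s t k k'
  · exact (this h.symm hj.symm (fun i h1 h2 => (hmin i h1 h2).symm) k' hkj' hk' hkf' k hkj hk hkf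
      (by omega)).symm
  rcases Nat.eq_zero_or_pos k' with rfl | h0
  · have hret := h.symm.altPt_return hkf' k
    obtain rfl : j = k + 1 := by
      by_contra hne
      exact hmin (k + 1) (by omega) (by omega) (by rw [hkf, ← hret]; congr 1; omega)
    rw [h.altVec_succ_of_fixed hk hkf, ← h.altVec_of_ascending (q := q) hk, altVec, altVec,
      add_comm k 1, alternatingWord_add, List.map_append, List.prod_append, Module.End.mul_apply]
    have h1 := h.symm.altVec_succ_of_fixed (q := q) hk' hkf'
    rw [h.symm.altPt_zero] at h1
    rw [altVec, zero_add] at h1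
    rw [h1, map_smul]
    simp
  · exact absurd (h.altPt_eq_of_fixed hle hk hk' hkf') (hmin k' h0 hkj')

theorem prod_alternatingWord_eq (h : IsDihedralMin cs σ ht s t m) (hq : q * (q + vinv - v) = 1)
    {n : ℕ} (hn : altPt cs σ m s t n = altPt cs σ m t s n) (l : List B)
    (hl : ∀ b ∈ l, b = s ∨ b = t) :
    ((alternatingWord t s n).map (Tq cs σ ht q)).prod ((l.map (Tq cs σ ht q)).prod (Mstd m)) =
      ((alternatingWord s t n).map (Tq cs σ ht q)).prod
        ((l.map (Tq cs σ ht q)).prod (Mstd m)) := by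
  classical
  induction n using Nat.strong_induction_on generalizing l with
  | _ n ih =>
  rcases Nat.eq_zero_or_pos n with rfl | hpos
  · rfl
  have hex : ∃ j, 1 ≤ j ∧ altPt cs σ m s t j = altPt cs σ m t s j := ⟨n, hpos, hn⟩
  obtain ⟨hj1, hj⟩ := Nat.find_spec hex
  have hjn : Nat.find hex ≤ n := Nat.find_min' hex ⟨hpos, hn⟩
  have hjmin : ∀ i, 1 ≤ i → i < Nat.find hex → altPt cs σ m s t i ≠ altPt cs σ m t s i :=
    fun i h1 h2 h3 => Nat.find_min hex h2 ⟨h1, h3⟩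
  generalize Nat.find hex = j at *
  obtain ⟨i, rfl⟩ := Nat.exists_eq_add_of_le hjn
  have hfirst := prod_alternatingWord_Tq_eq_word h.act hq
    (h.altVec_eq_of_first_meet (q := q) hj hjmin) l hl
  have hi : altPt cs σ m s t i = altPt cs σ m t s i := by
    have hy : altPt cs σ (altPt cs σ m s t j) s t i = altPt cs σ (altPt cs σ m s t j) t s i := by
      have h1 := hn
      unfold altPt at h1 hj
      rw [alternatingWord_add t s, alternatingWord_add s t, wordProd_append, wordProd_append,
        h.act.2, h.act.2, ← hj] at h1
      unfold altPt
      by_cases hev : Even j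
      · simpa [hev] using h1
      · simpa [hev] using h1.symm
    have := altPt_wordProd_eq h.act hy (alternatingWord t s j).reverse
      (fun b hb => mem_alternatingWord (by simpa using hb))
    rwa [wordProd_reverse, altPt.eq_def cs σ m s t j, h.act.inv_apply] at this
  have hih := ih i (by omega) hi (alternatingWord s t j ++ l) (by
    intro b hb
    rcases List.mem_append.1 hb with hb | hb
    · exact (mem_alternatingWord hb).symm
    · exact hl b hb)
  simp only [List.map_append, List.prod_append, Module.End.mul_apply] at hih
  rw [alternatingWord_add t s, alternatingWord_add s t, List.map_append, List.map_append,
    List.prod_append, List.prod_append, Module.End.mul_apply, Module.End.mul_apply, hfirst]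
  by_cases hev : Even j
  · simpa [hev] using hih
  · simpa [hev] using hih.symm

end IsDihedralMin

theorem exists_isDihedralMin (hact : IsActionOf σ) (hqp : IsQP cs σ ht)
    (hht : ∃ n : X → ℕ, ∀ x, ht x = n x / 2) (s t : B) (x : X) :
    ∃ m, IsDihedralMin cs σ ht s t m ∧ ∃ l : List B, (∀ b ∈ l, b = s ∨ b = t) ∧
      σ (cs.wordProd l) m = x ∧ ht (σ (cs.wordProd l) m) = ht m + l.length := by
  obtain ⟨n, hn⟩ := hht
  obtain ⟨_, ⟨l₀, hl₀, rfl⟩, hmin⟩ := (measure n).wf.has_min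
    {y | ∃ l : List B, (∀ b ∈ l, b = s ∨ b = t) ∧ σ (cs.wordProd l) x = y} ⟨_, [], by simp, rfl⟩
  have hm : IsDihedralMin cs σ ht s t (σ (cs.wordProd l₀) x) := by
    refine ⟨hact, hqp, fun l hl => ?_⟩
    have := hmin (σ (cs.wordProd (l ++ l₀)) x) ⟨_, fun b hb => ?_, rfl⟩
    · rw [wordProd_append, hact.2] at this
      rw [hn, hn]
      have : n (σ (cs.wordProd l₀) x) ≤ n (σ (cs.wordProd l) (σ (cs.wordProd l₀) x)) := not_lt.1 this
      gcongr
    · rcases List.mem_append.1 hb with hb | hb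
      exacts [hl b hb, hl₀ b hb]
  obtain ⟨l, hl, hlx, hasc⟩ := hqp.exists_ascending hact {b | b = s ∨ b = t} hm.min l₀.reverse
    (fun b hb => hl₀ b (by simpa using hb))
  rw [wordProd_reverse, hact.inv_apply] at hlx
  exact ⟨_, hm, l, hl, hlx, hasc⟩

/-- The operators `Tq` satisfy the braid relations. -/
theorem prod_map_Tq_eq_of_isReduced (hact : IsActionOf σ) (hqp : IsQP cs σ ht)
    (hht : ∃ n : X → ℕ, ∀ x, ht x = n x / 2) (hq : q * (q + vinv - v) = 1) {l l' : List B}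
    (hl : cs.IsReduced l) (hl' : cs.IsReduced l') (h : cs.wordProd l = cs.wordProd l') :
    (l.map (Tq cs σ ht q)).prod = (l'.map (Tq cs σ ht q)).prod := by
  have braid : ∀ s t n, cs.wordProd (alternatingWord t s n) = cs.wordProd (alternatingWord s t n) →
      ((alternatingWord t s n).map (Tq cs σ ht q)).prod =
        ((alternatingWord s t n).map (Tq cs σ ht q)).prod := by
    refine fun s t n hst => end_ext_Mstd fun x => ?_
    obtain ⟨m, hm, l, hl, rfl, hasc⟩ := exists_isDihedralMin hact hqp hht s t x
    rw [← prod_map_Tq_of_ascending (q := q) hact hqp.1 l m hasc]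
    exact hm.prod_alternatingWord_eq hq (by rw [altPt, hst, altPt]) l hl
  refine cs.prod_map_eq_of_isReduced _ (fun i j n hij => ?_) hl hl' h
  rw [altFrom_eq_alternatingWord, altFrom_eq_alternatingWord] at hij ⊢
  split_ifs at hij ⊢ with hev
  · exact braid _ _ _ hij
  · exact braid _ _ _ hij

theorem prod_map_reverse_mul_prod_map {G : Type*} [Monoid G] {f g : B → G}
    (h : ∀ i, f i * g i = 1) (l : List B) : (l.reverse.map f).prod * (l.map g).prod = 1 := by
  induction l with
  | nil => simp
  | cons i l ih =>
    simp only [List.reverse_cons, List.map_append, List.map_cons, List.map_nil, List.prod_append,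
      List.prod_cons, List.prod_nil, mul_one]
    rw [mul_assoc, ← mul_assoc (f i), h, one_mul, ih]

theorem Tq_mul_TqBar (hact : IsActionOf σ) (hq : q * (q + vinv - v) = 1) (i : B) :
    Tq cs σ ht q i * TqBar cs σ ht q i = 1 := by
  refine LinearMap.ext fun m => ?_
  rw [Module.End.mul_apply, Tq_TqBar_apply hact hq, Module.End.one_apply]

theorem TqBar_mul_Tq (hact : IsActionOf σ) (hq : q * (q + vinv - v) = 1) (i : B) :
    TqBar cs σ ht q i * Tq cs σ ht q i = 1 := by
  refine LinearMap.ext fun m => ?_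
  rw [Module.End.mul_apply, TqBar_Tq_apply hact hq, Module.End.one_apply]

/-- The product of the operators `TqBar` along a reduced word depends only on the element
represented by this word. -/
theorem prod_map_TqBar_eq_of_isReduced (hact : IsActionOf σ) (hqp : IsQP cs σ ht)
    (hht : ∃ n : X → ℕ, ∀ x, ht x = n x / 2) (hq : q * (q + vinv - v) = 1) {l l' : List B}
    (hl : cs.IsReduced l) (hl' : cs.IsReduced l') (h : cs.wordProd l = cs.wordProd l') :
    (l.map (TqBar cs σ ht q)).prod = (l'.map (TqBar cs σ ht q)).prod := by
  have h1 := prod_map_reverse_mul_prod_map (TqBar_mul_Tq (cs := cs) (ht := ht) hact hq) l.reverse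
  rw [List.reverse_reverse] at h1
  refine left_inv_eq_right_inv h1 ?_
  rw [prod_map_Tq_eq_of_isReduced hact hqp hht hq hl.reverse hl'.reverse
    (by rw [wordProd_reverse, wordProd_reverse, h])]
  exact prod_map_reverse_mul_prod_map (Tq_mul_TqBar hact hq) l'

end Module

section Twisted

open CoxeterSystem

/-- `𝒦` is a quasiparabolic `θ`-twisted conjugacy class of twisted involutions, acted upon
through `σ` and with height function `ht = ℓ/2`. -/
structure IsTwInvolutionClass (cs : CoxeterSystem M W) (θ : W ≃* W) (𝒦 : Set W)
    (σ : W → ↥𝒦 → ↥𝒦) (ht : ↥𝒦 → ℚ) : Prop where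
  simpleOnto : SimpleOnto cs θ
  involutive : ∀ w : W, θ (θ w) = w
  isTwClass : IsTwClass θ 𝒦
  map_eq_inv : ∀ x ∈ 𝒦, θ x = x⁻¹
  isQPClass : IsQPClass cs θ 𝒦
  coe_act : ∀ (w : W) (x : ↥𝒦), (σ w x : W) = twConj θ w (x : W)
  ht_eq : ∀ x : ↥𝒦, ht x = htL cs (x : W)

namespace IsTwInvolutionClass

variable {cs : CoxeterSystem M W} {θ : W ≃* W} {𝒦 : Set W} {σ : W → ↥𝒦 → ↥𝒦} {ht : ↥𝒦 → ℚ} {q : A}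

theorem exists_star (h : IsTwInvolutionClass cs θ 𝒦 σ ht) :
    ∃ star : B → B, (∀ i, θ (cs.simple i) = cs.simple (star i)) ∧
      ∀ i, θ (cs.simple (star i)) = cs.simple i := by
  have : ∀ i, ∃ j, θ (cs.simple i) = cs.simple j := fun i => by
    have hi : θ (cs.simple i) ∈ ⇑θ '' Set.range cs.simple := ⟨_, ⟨i, rfl⟩, rfl⟩
    rw [h.simpleOnto] at hi
    obtain ⟨j, hj⟩ := hi
    exact ⟨j, hj.symm⟩
  choose star hstar using this
  exact ⟨star, hstar, fun i => by rw [← hstar, h.involutive]⟩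

theorem coe_simple (h : IsTwInvolutionClass cs θ 𝒦 σ ht) {i j : B}
    (hij : θ (cs.simple i) = cs.simple j) (x : ↥𝒦) :
    (σ (cs.simple i) x : W) = cs.simple i * x * cs.simple j := by
  rw [h.coe_act, twConj, hij, inv_simple]

theorem isActionOf (h : IsTwInvolutionClass cs θ 𝒦 σ ht) : IsActionOf σ := by
  refine ⟨fun x => Subtype.ext ?_, fun w w' x => Subtype.ext ?_⟩
  · rw [h.coe_act]
    simp [twConj]
  · rw [h.coe_act, h.coe_act, h.coe_act]
    simp [twConj, mul_assoc]

theorem ht_eq_length (h : IsTwInvolutionClass cs θ 𝒦 σ ht) (x : ↥𝒦) :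
    ht x = (cs.length (x : W) : ℚ) / 2 := h.ht_eq x

theorem ht_lt_iff (h : IsTwInvolutionClass cs θ 𝒦 σ ht) {x y : ↥𝒦} :
    ht x < ht y ↔ cs.length (x : W) < cs.length (y : W) := by
  rw [h.ht_eq_length, h.ht_eq_length, div_lt_div_iff_of_pos_right two_pos, Nat.cast_lt]

theorem isQP (h : IsTwInvolutionClass cs θ 𝒦 σ ht) : IsQP cs σ ht := by
  refine ⟨fun i x => ?_, fun r hr x hx => Subtype.ext ?_, fun r hr x i h1 h2 => Subtype.ext ?_⟩
  · obtain ⟨star, hstar, -⟩ := h.exists_star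
    rw [h.ht_eq_length, h.ht_eq_length, h.coe_simple (hstar i)]
    simp only [Set.mem_insert_iff, Set.mem_singleton_iff]
    have h1 := cs.length_simple_mul x i
    have h2 := cs.length_mul_simple (cs.simple i * x) (star i)
    generalize cs.length (cs.simple i * x * cs.simple (star i)) = a at *
    generalize cs.length (cs.simple i * x) = b at *
    generalize cs.length (x : W) = c at *
    have : a + 2 = c ∨ a = c ∨ a = c + 2 := by omega
    rcases this with rfl | rfl | rfl
    · left; push_cast; ring
    · right; left; ring
    · right; right; push_cast; ring
  · rw [h.coe_act]
    refine h.isQPClass.1 r hr x x.2 ?_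
    rwa [h.ht_eq, h.ht_eq, h.coe_act] at hx
  · rw [h.coe_act, h.coe_act]
    simp only [h.ht_eq, h.coe_act] at h1 h2
    exact h.isQPClass.2 r hr x x.2 i h1 h2

theorem inv_mem (h : IsTwInvolutionClass cs θ 𝒦 σ ht) (x : ↥𝒦) : (x : W)⁻¹ ∈ 𝒦 := by
  have := (σ (x : W)⁻¹ x).2
  rw [h.coe_act, twConj, inv_mul_cancel, one_mul, map_inv, inv_inv, h.map_eq_inv x x.2] at this
  exact this

theorem prod_map_TqBar_eq_of_isReduced (h : IsTwInvolutionClass cs θ 𝒦 σ ht)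
    (hq : q * (q + vinv - v) = 1) {l l' : List B} (hl : cs.IsReduced l) (hl' : cs.IsReduced l')
    (hll' : cs.wordProd l = cs.wordProd l') :
    (l.map (TqBar cs σ ht q)).prod = (l'.map (TqBar cs σ ht q)).prod :=
  _root_.prod_map_TqBar_eq_of_isReduced h.isActionOf h.isQP ⟨_, h.ht_eq_length⟩ hq hl hl' hll'

/-- The image of `Mstd x` under the bar operator, computed from a chosen reduced word for `x`. -/
def barVec (cs : CoxeterSystem M W) (σ : W → ↥𝒦 → ↥𝒦) (ht : ↥𝒦 → ℚ) (q : A) (n : ℕ) (x : ↥𝒦) :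
    ↥𝒦 →₀ A :=
  q ^ n • ((cs.exists_isReduced (x : W)).choose.map (TqBar cs σ ht q)).prod
    (Mstd (σ (x : W)⁻¹ x))

theorem barVec_eq (h : IsTwInvolutionClass cs θ 𝒦 σ ht) (hq : q * (q + vinv - v) = 1) (n : ℕ)
    {x x' : ↥𝒦} (hx' : (x' : W) = (x : W)⁻¹) {l : List B} (hl : cs.IsReduced l)
    (hlx : cs.wordProd l = x) :
    barVec cs σ ht q n x = q ^ n • (l.map (TqBar cs σ ht q)).prod (Mstd x') := by
  have hspec := (cs.exists_isReduced (x : W)).choose_spec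
  have hx : σ (x : W)⁻¹ x = x' := Subtype.ext (by
    rw [h.coe_act, twConj, inv_mul_cancel, one_mul, map_inv, inv_inv, h.map_eq_inv x x.2, hx'])
  rw [barVec, hx, h.prod_map_TqBar_eq_of_isReduced hq hspec.1 hl (by rw [← hspec.2, hlx])]

theorem barVec_of_lt (h : IsTwInvolutionClass cs θ 𝒦 σ ht) (hq : q * (q + vinv - v) = 1) (n : ℕ)
    {i : B} {x : ↥𝒦} (hx : ht x < ht (σ (cs.simple i) x)) :
    barVec cs σ ht q n (σ (cs.simple i) x) = TqBar cs σ ht q i (barVec cs σ ht q n x) := by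
  obtain ⟨star, hstar, hstar'⟩ := h.exists_star
  obtain ⟨l, hl, hlx⟩ := cs.exists_isReduced (x : W)
  set x' : ↥𝒦 := ⟨_, h.inv_mem x⟩
  have hlen : cs.length (x : W) = l.length := by rw [hlx]; exact hl
  have hword : cs.wordProd (i :: l ++ [star i]) = (σ (cs.simple i) x : W) := by
    simp [h.coe_simple (hstar i), CoxeterSystem.wordProd_append, CoxeterSystem.wordProd_cons, hlx,
      mul_assoc]
  have hinv : (σ (cs.simple (star i)) x' : W) = (σ (cs.simple i) x : W)⁻¹ := by
    rw [h.coe_simple (hstar i), h.coe_simple (hstar' i)]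
    simp [x', mul_assoc]
  rw [h.ht_lt_iff] at hx
  have hred : cs.IsReduced (i :: l ++ [star i]) := by
    rw [CoxeterSystem.IsReduced, hword]
    refine le_antisymm (hword ▸ cs.length_wordProd_le _) ?_
    rw [h.coe_simple (hstar i)] at hx ⊢
    have h1 := cs.length_simple_mul x i
    have h2 := cs.length_mul_simple (cs.simple i * x) (star i)
    simp only [List.length_append, List.length_cons, List.length_nil]
    omega
  have hup : ht x' < ht (σ (cs.simple (star i)) x') := by
    rw [h.ht_lt_iff, hinv, length_inv]
    simpa [x'] using hx
  rw [h.barVec_eq hq n hinv hred hword, h.barVec_eq hq n (x' := x') rfl hl hlx.symm,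
    ← Tq_of_lt (q := q) hup, List.cons_append, List.map_cons, List.map_append, List.prod_cons,
    List.prod_append, Module.End.mul_apply, Module.End.mul_apply]
  simp only [List.map_cons, List.map_nil, List.prod_cons, List.prod_nil, mul_one]
  rw [TqBar_Tq_apply h.isActionOf hq, map_smul]

theorem TqBar_barVec_of_eq (h : IsTwInvolutionClass cs θ 𝒦 σ ht) (hq : q * (q + vinv - v) = 1)
    (n : ℕ) {i : B} {x : ↥𝒦} (hx : ht (σ (cs.simple i) x) = ht x) :
    TqBar cs σ ht q i (barVec cs σ ht q n x) = (q + vinv - v) • barVec cs σ ht q n x := by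
  obtain ⟨star, hstar, hstar'⟩ := h.exists_star
  set x' : ↥𝒦 := ⟨_, h.inv_mem x⟩
  have hfix := congrArg Subtype.val (h.isQP.simple_fixed hx)
  rw [h.coe_simple (hstar i)] at hfix
  have hcomm : cs.simple i * x = x * cs.simple (star i) := by
    conv_rhs => rw [← hfix]
    simp [mul_assoc]
  have hfix' : σ (cs.simple (star i)) x' = x' := Subtype.ext (by
    have := congrArg (·⁻¹) hfix
    rw [h.coe_simple (hstar' i)]
    simpa [x', mul_assoc] using this)
  have hM : TqBar cs σ ht q (star i) (Mstd x') = (q + vinv - v) • Mstd x' :=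
    TqBar_of_eq (by rw [hfix'])
  have key : ∀ l : List B, cs.IsReduced (i :: l) → cs.IsReduced (l ++ [star i]) →
      cs.wordProd (i :: l) = cs.wordProd (l ++ [star i]) →
      TqBar cs σ ht q i ((l.map (TqBar cs σ ht q)).prod (Mstd x')) =
        (q + vinv - v) • (l.map (TqBar cs σ ht q)).prod (Mstd x') := by
    intro l h1 h2 h12
    have := LinearMap.congr_fun (h.prod_map_TqBar_eq_of_isReduced hq h1 h2 h12) (Mstd x')
    rw [List.map_cons, List.prod_cons, Module.End.mul_apply, List.map_append, List.prod_append,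
      Module.End.mul_apply] at this
    rw [this]
    simp [hM]
  rcases cs.length_simple_mul x i with hs | hs
  · obtain ⟨l, hl, hlx⟩ := cs.exists_isReduced (x : W)
    have hlen : cs.length (x : W) = l.length := by rw [hlx]; exact hl
    have h1 : cs.wordProd (i :: l) = cs.simple i * x := by rw [wordProd_cons, hlx]
    have h2 : cs.wordProd (l ++ [star i]) = cs.simple i * x := by
      rw [hcomm, wordProd_append, hlx]; simp
    rw [h.barVec_eq hq n (x' := x') rfl hl hlx.symm, map_smul, smul_comm,
      key l (by rw [CoxeterSystem.IsReduced, h1, hs, hlen]; simp)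
        (by rw [CoxeterSystem.IsReduced, h2, hs, hlen]; simp)
        (h1.trans h2.symm)]
  · obtain ⟨l, hl, hlx⟩ := cs.exists_isReduced (cs.simple i * x)
    have hlen : cs.length (cs.simple i * x) = l.length := by rw [hlx]; exact hl
    have h1 : cs.wordProd (i :: l) = x := by rw [wordProd_cons, ← hlx]; simp
    have h2 : cs.wordProd (l ++ [star i]) = x := by
      rw [wordProd_append, ← hlx]; simpa using hfix
    have hr1 : cs.IsReduced (i :: l) := by rw [CoxeterSystem.IsReduced, h1, ← hs, hlen]; simp
    have hr2 : cs.IsReduced (l ++ [star i]) := by rw [CoxeterSystem.IsReduced, h2, ← hs, hlen]; simp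
    have hk := key l hr1 hr2 (h1.trans h2.symm)
    rw [h.barVec_eq hq n (x' := x') rfl hr1 h1, map_smul, List.map_cons, List.prod_cons,
      Module.End.mul_apply, hk, map_smul, hk, smul_comm]

theorem wMin_rotate (h : IsTwInvolutionClass cs θ 𝒦 σ ht) {star : B → B}
    (hstar : ∀ i, θ (cs.simple i) = cs.simple (star i)) {x : ↥𝒦} (hx : WMin cs σ ht x)
    (l k : List B) (hlk : cs.wordProd (l ++ k) = x) (hlen : (l ++ k).length = cs.length (x : W)) :
    (∀ i ∈ l, ht (σ (cs.simple i) x) = ht x) ∧ cs.wordProd (k ++ l.map star) = x := by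
  induction l generalizing k with
  | nil => simpa using hlk
  | cons i l ih =>
    have hw : (σ (cs.simple i) x : W) = cs.wordProd (l ++ (k ++ [star i])) := by
      rw [h.coe_simple (hstar i), ← hlk, ← List.append_assoc, wordProd_append _ (l ++ k)]
      simp [wordProd_cons]
    have hle : cs.length (σ (cs.simple i) x : W) ≤ cs.length (x : W) := by
      rw [hw, ← hlen]
      refine (cs.length_wordProd_le _).trans ?_
      simp
      omega
    have heq : ht (σ (cs.simple i) x) = ht x := by
      refine le_antisymm ?_ (hx i)
      rw [← not_lt, h.ht_lt_iff, not_lt]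
      exact hle
    have hfix := h.isQP.simple_fixed heq
    obtain ⟨h1, h2⟩ := ih (k ++ [star i]) (by rw [← hw, hfix]) (by
      rw [← hlen]; simp; omega)
    refine ⟨by simpa [heq] using h1, by simpa using h2⟩

theorem barVec_of_wMin (h : IsTwInvolutionClass cs θ 𝒦 σ ht) (hq : q * (q + vinv - v) = 1)
    {x : ↥𝒦} (hx : WMin cs σ ht x) : barVec cs σ ht q (sInf (cs.length '' 𝒦)) x = Mstd x := by
  obtain ⟨star, hstar, -⟩ := h.exists_star
  have hlen : cs.length (x : W) = sInf (cs.length '' 𝒦) := by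
    obtain ⟨y, hy, hymin⟩ := Nat.sInf_mem (s := cs.length '' 𝒦) ⟨_, _, x.2, rfl⟩
    have := h.isQP.eq_of_wMin h.isActionOf (x₀ := ⟨y, hy⟩) (fun w => ?_) hx ?_
    · rw [this, hymin]
    · rw [← not_lt, h.ht_lt_iff, not_lt, hymin]
      exact Nat.sInf_le ⟨_, Subtype.mem _, rfl⟩
    · obtain ⟨x₀, hx₀⟩ := h.isTwClass
      obtain ⟨w, rfl⟩ := hx₀.subset hy
      obtain ⟨w', hw'⟩ := hx₀.subset x.2
      refine ⟨w' * w⁻¹, Subtype.ext ?_⟩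
      rw [h.coe_act, ← hw']
      simp [twConj, mul_assoc]
  obtain ⟨l, hl, hlx⟩ := cs.exists_isReduced (x : W)
  have hlen' : cs.length (x : W) = l.length := by rw [hlx]; exact hl
  obtain ⟨h1, h2⟩ := h.wMin_rotate hstar hx l [] (by simp [hlx]) (by simp [hlen'])
  have hmap : ∀ l : List B, cs.wordProd (l.map star) = θ (cs.wordProd l) := fun l => by
    induction l with
    | nil => simp
    | cons i l ih => simp [wordProd_cons, ih, hstar]
  rw [List.nil_append, hmap, ← hlx, h.map_eq_inv x x.2] at h2
  have hprod : ∀ l : List B, (∀ i ∈ l, ht (σ (cs.simple i) x) = ht x) →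
      (l.map (TqBar cs σ ht q)).prod (Mstd x) = (q + vinv - v) ^ l.length • Mstd x := fun l => by
    induction l with
    | nil => simp
    | cons i l ih =>
      intro hl
      rw [List.map_cons, List.prod_cons, Module.End.mul_apply, ih fun j hj => hl j (by simp [hj]),
        map_smul, TqBar_of_eq (hl i (by simp)), smul_smul, List.length_cons, pow_succ]
  rw [h.barVec_eq hq _ h2.symm hl hlx.symm, hprod l h1, smul_smul, ← hlen', hlen, ← mul_pow, hq,
    one_pow, one_smul]

/-- The operators `TqBar` give rise to a bar operator. -/
theorem exists_bar (h : IsTwInvolutionClass cs θ 𝒦 σ ht) (hq : q * (q + vinv - v) = 1)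
    (hbar : Abar q = q + vinv - v) :
    ∃ β : (↥𝒦 →₀ A) → (↥𝒦 →₀ A),
      ((∀ m m', β (m + m') = β m + β m') ∧
        (∀ (f : A) (m : ↥𝒦 →₀ A), β (f • m) = Abar f • β m) ∧
        (∀ (i : B) (m : ↥𝒦 →₀ A),
          β (Tq cs σ ht q i m) = Tq cs σ ht q i (β m) + (vinv - v) • β m) ∧
        ∀ x : ↥𝒦, WMin cs σ ht x → β (Mstd x) = Mstd x) ∧
      ∀ x x' : ↥𝒦, (x' : W) = (x : W)⁻¹ →
        ∀ l : List B, cs.wordProd l = (x : W) → l.length = cs.length (x : W) →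
          β (Mstd x) = q ^ sInf (cs.length '' 𝒦) • (l.map (TqBar cs σ ht q)).prod (Mstd x') := by
  have Abar_add : ∀ f g, Abar (f + g) = Abar f + Abar g := map_add LaurentPolynomial.invert
  have Abar_mul : ∀ f g, Abar (f * g) = Abar f * Abar g := map_mul LaurentPolynomial.invert
  have Abar_zero : Abar 0 = 0 := map_zero LaurentPolynomial.invert
  have Abar_one : Abar 1 = 1 := map_one LaurentPolynomial.invert
  have Abar_sub : Abar (v - vinv) = vinv - v := by
    simp [Abar, v, vinv]
  set b := barVec cs σ ht q (sInf (cs.length '' 𝒦)) with hb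
  set β : (↥𝒦 →₀ A) → (↥𝒦 →₀ A) := fun m => m.sum fun x a => Abar a • b x with hβ
  have β_add : ∀ m m', β (m + m') = β m + β m' := fun m m' =>
    Finsupp.sum_add_index' (by simp [Abar_zero]) (by simp [Abar_add, add_smul])
  have β_smul : ∀ (f : A) (m : ↥𝒦 →₀ A), β (f • m) = Abar f • β m := fun f m => by
    rw [hβ]
    simp only
    rw [Finsupp.sum_smul_index' (by simp [Abar_zero]), Finsupp.smul_sum]
    simp [Abar_mul, mul_smul]
  have β_std : ∀ x, β (Mstd x) = b x := fun x => by
    simp [hβ, Mstd, Finsupp.sum_single_index, Abar_zero, Abar_one]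
  refine ⟨β, ⟨β_add, β_smul, fun i m => ?_, fun x hx => ?_⟩, fun x x' hx' l hl hlen => ?_⟩
  · rw [← TqBar_apply]
    induction m using Finsupp.induction_linear with
    | zero =>
      have h0 : β 0 = 0 := by simp [hβ]
      rw [map_zero, h0, map_zero]
    | add f g hf hg => rw [map_add, β_add, hf, hg, β_add, map_add]
    | single x a =>
      rw [show Finsupp.single x a = a • Mstd x by simp [Mstd], map_smul, β_smul, β_smul, map_smul]
      congr 1
      rw [β_std]
      rcases lt_trichotomy (ht x) (ht (σ (cs.simple i) x)) with hx | hx | hx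
      · rw [Tq_of_lt hx, β_std, hb, h.barVec_of_lt hq _ hx]
      · rw [Tq_of_eq hx.symm, β_smul, β_std, hbar, hb, h.TqBar_barVec_of_eq hq _ hx.symm]
      · have hss := h.isActionOf.simple_simple (cs := cs) i x
        have hup := h.barVec_of_lt hq (sInf (cs.length '' 𝒦)) (x := σ (cs.simple i) x) (i := i)
          (by rwa [hss])
        rw [hss, ← hb] at hup
        rw [Tq_of_gt hx, β_add, β_smul, β_std, β_std, Abar_sub, hup,
          TqBar_TqBar_apply h.isActionOf hq]
  · rw [β_std, hb, h.barVec_of_wMin hq hx]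
  · rw [β_std, hb, h.barVec_eq hq _ hx' (by rw [CoxeterSystem.IsReduced, hl, hlen]) hl]

end IsTwInvolutionClass

end Twisted

/-- Let `θ` be an involutive automorphism preserving `S`, and let `𝒦` be a
quasiparabolic `θ`-twisted conjugacy class of twisted involutions (with height `ht = ℓ/2`).
Then the module `ℳ` on `𝒦` has a bar operator `β` satisfying
`β(M_x) = v^{ℓ₀} · (T̄_{s₁} ∘ ⋯ ∘ T̄_{s_k})(M_{x⁻¹})` for every reduced word `s₁⋯s_k` of
`x ∈ 𝒦`, where `ℓ₀` is the minimal length in `𝒦`; likewise `𝒩` has a bar operator `β′`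
satisfying `β′(N_x) = (−1)^{ℓ₀} v^{−ℓ₀} · (Ū_{s₁} ∘ ⋯ ∘ Ū_{s_k})(N_{x⁻¹})`. -/
theorem stmt10 (cs : CoxeterSystem M W) (θ : W ≃* W) (hθS : SimpleOnto cs θ)
    (hθ2 : ∀ w : W, θ (θ w) = w) (𝒦 : Set W) (hK : IsTwClass θ 𝒦)
    (htw : ∀ x ∈ 𝒦, θ x = x⁻¹) (hqp : IsQPClass cs θ 𝒦)
    (σ : W → ↥𝒦 → ↥𝒦) (hσ : ∀ (w : W) (x : ↥𝒦), ((σ w x : W)) = twConj θ w (x : W))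
    (ht : ↥𝒦 → ℚ) (hht : ∀ x : ↥𝒦, ht x = htL cs (x : W))
    (l₀ : ℕ) (hl₀ : l₀ = sInf (cs.length '' 𝒦)) :
    (∃ β : (↥𝒦 →₀ A) → (↥𝒦 →₀ A),
      IsBarOpM cs σ ht β ∧
      ∀ x x' : ↥𝒦, (x' : W) = (x : W)⁻¹ →
        ∀ l : List B, cs.wordProd l = (x : W) → l.length = cs.length (x : W) →
          β (Mstd x) =
            (LaurentPolynomial.T (l₀ : ℤ) : A) •
              ((l.map (TsBar cs σ ht)).prod (Mstd x'))) ∧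
    (∃ β : (↥𝒦 →₀ A) → (↥𝒦 →₀ A),
      IsBarOpN cs σ ht β ∧
      ∀ x x' : ↥𝒦, (x' : W) = (x : W)⁻¹ →
        ∀ l : List B, cs.wordProd l = (x : W) → l.length = cs.length (x : W) →
          β (Mstd x) =
            (((-1 : A) ^ l₀) * LaurentPolynomial.T (-(l₀ : ℤ))) •
              ((l.map (UsBar cs σ ht)).prod (Mstd x'))) := by
  have h : IsTwInvolutionClass cs θ 𝒦 σ ht := ⟨hθS, hθ2, hK, htw, hqp, hσ, hht⟩
  have hv : v * vinv = 1 := by rw [v, vinv, ← T_add]; simp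
  have hbar : Abar v = vinv := by simp [Abar, v, vinv]
  have hbar' : Abar vinv = v := by simp [Abar, v, vinv]
  constructor
  · obtain ⟨β, hβ, hβ'⟩ := h.exists_bar (q := v) (by linear_combination hv)
      (by rw [hbar]; ring)
    refine ⟨β, hβ, fun x x' hx' l hl hlen => ?_⟩
    rw [hβ' x x' hx' l hl hlen, ← hl₀, v, T_pow, mul_one]
    rfl
  · obtain ⟨β, hβ, hβ'⟩ := h.exists_bar (q := -vinv) (by linear_combination hv)
      (by rw [show Abar (-vinv) = -Abar vinv from map_neg LaurentPolynomial.invert _, hbar']; ring)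
    refine ⟨β, hβ, fun x x' hx' l hl hlen => ?_⟩
    rw [hβ' x x' hx' l hl hlen, ← hl₀, neg_pow, vinv, T_pow, mul_neg_one]
    rfl

end
end

section
/- Let θ : W → W be a group automorphism mapping S onto itself, let 𝒦 ⊆ W be a quasiparabolic θ-twisted conjugacy class, and suppose x ∈ 𝒦 is the unique W-minimal element of 𝒦. Set J = {s ∈ S : ℓ(s·x) < ℓ(x)} and let W_J be the subgroup of W generated by J. Then {z ∈ W : z·x = x·θ(z)} = {z ∈ W : z·W_J·θ(z)⁻¹ = W_J}, where z·W_J·θ(z)⁻¹ denotes the set {z·h·θ(z)⁻¹ : h ∈ W_J}. -/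
noncomputable section

variable {B W : Type*} [Group W] {M : CoxeterMatrix B}

open Classical in
/-- The action of a simple reflection on signed elements of `W`: conjugate by `s i`, and
change the sign exactly when the element is `s i` itself. -/
def signedConj (cs : CoxeterSystem M W) (i : B) : Function.End (W × ZMod 2) := fun p =>
  (cs.simple i * p.1 * cs.simple i, p.2 + if p.1 = cs.simple i then 1 else 0)

theorem simple_mul_pow_mul_simple (cs : CoxeterSystem M W) (i j : B) (k : ℕ) :
    (cs.simple i * cs.simple j) ^ k * cs.simple j * (cs.simple i * cs.simple j) ^ k =
      cs.simple j := by
  induction k with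
  | zero => simp
  | succ k ih =>
    rw [pow_succ]
    nth_rw 2 [← pow_succ]
    rw [pow_succ']
    calc _ = (cs.simple i * cs.simple j) ^ k *
          (cs.simple i * (cs.simple j * cs.simple j) * cs.simple i * cs.simple j) *
          (cs.simple i * cs.simple j) ^ k := by simp only [mul_assoc]
      _ = _ := by simpa using ih

open Classical in
theorem signedConj_mul_pow_apply (cs : CoxeterSystem M W) (i j : B) (k : ℕ) (t : W)
    (ε : ZMod 2) :
    ((signedConj cs i * signedConj cs j) ^ k) (t, ε) =
      ((cs.simple i * cs.simple j) ^ k * t * ((cs.simple i * cs.simple j) ^ k)⁻¹,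
        ε + ∑ l ∈ Finset.range (2 * k),
          if t = cs.simple j * (cs.simple i * cs.simple j) ^ l then 1 else 0) := by
  induction k with
  | zero => simp [Function.End.one_def]
  | succ k ih =>
    have hstep : ∀ p : W × ZMod 2, (signedConj cs i * signedConj cs j) p =
        (cs.simple i * (cs.simple j * p.1 * cs.simple j) * cs.simple i,
          p.2 + (if p.1 = cs.simple j then 1 else 0) +
            if cs.simple j * p.1 * cs.simple j = cs.simple i then 1 else 0) := fun _ => rfl
    have hmul : ((signedConj cs i * signedConj cs j) ^ (k + 1)) (t, ε) =
        (signedConj cs i * signedConj cs j)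
          (((signedConj cs i * signedConj cs j) ^ k) (t, ε)) := by
      rw [pow_succ']; rfl
    have hsq : ∀ a : W, cs.simple j * a * cs.simple j = cs.simple i ↔
        a = cs.simple j * cs.simple i * cs.simple j := by
      intro a
      constructor
      · intro h; rw [← h]; simp [mul_assoc]
      · rintro rfl; simp [mul_assoc]
    have hp := simple_mul_pow_mul_simple cs i j k
    rw [hmul, ih, hstep, hsq, show 2 * (k + 1) = 2 * k + 1 + 1 by ring,
      Finset.sum_range_succ, Finset.sum_range_succ]
    set p := cs.simple i * cs.simple j with hpdef
    have h1 : p ^ k * t * (p ^ k)⁻¹ = cs.simple j ↔ t = cs.simple j * p ^ (2 * k) := by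
      have : cs.simple j = p ^ k * (cs.simple j * p ^ (2 * k)) * (p ^ k)⁻¹ := by
        rw [two_mul, pow_add]
        simp only [← mul_assoc]
        rw [hp]; simp
      nth_rw 1 [this]
      simp
    have h2 : p ^ k * t * (p ^ k)⁻¹ = cs.simple j * cs.simple i * cs.simple j ↔
        t = cs.simple j * p ^ (2 * k + 1) := by
      have : cs.simple j * cs.simple i * cs.simple j =
          p ^ k * (cs.simple j * p ^ (2 * k + 1)) * (p ^ k)⁻¹ := by
        rw [pow_succ', two_mul, pow_add, ← mul_assoc p, ← pow_succ', pow_succ]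
        have : p ^ k * (cs.simple j * (p ^ k * p * p ^ k)) * (p ^ k)⁻¹ =
          (p ^ k * cs.simple j * p ^ k) * p := by group
        rw [this, hp, hpdef, mul_assoc]
      rw [this]
      simp
    simp only [h1, h2, Prod.mk.injEq]
    refine ⟨?_, by ring⟩
    rw [pow_succ', hpdef]
    simp [mul_assoc]

theorem isLiftable_signedConj (cs : CoxeterSystem M W) : M.IsLiftable (signedConj cs) := by
  classical
  intro i j
  funext ⟨t, ε⟩
  have hper : ∀ l, cs.simple j * (cs.simple i * cs.simple j) ^ (M i j + l) =
      cs.simple j * (cs.simple i * cs.simple j) ^ l := by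
    intro l
    rw [pow_add, cs.simple_mul_simple_pow, one_mul]
  rw [signedConj_mul_pow_apply, cs.simple_mul_simple_pow, two_mul, Finset.sum_range_add]
  simp only [hper, CharTwo.add_self_eq_zero]
  simp [Function.End.one_def]

/-- The action of `W` on signed elements extending `signedConj`. -/
def signedAction (cs : CoxeterSystem M W) : W →* Function.End (W × ZMod 2) :=
  cs.lift ⟨signedConj cs, isLiftable_signedConj cs⟩

/-- The sign by which `w` acts on `t`; for a reflection `t` it is `1` exactly when `t` is a
right inversion of `w`. -/
def inversionSign (cs : CoxeterSystem M W) (w t : W) : ZMod 2 := (signedAction cs w (t, 0)).2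

open Classical in
theorem signedAction_simple_apply (cs : CoxeterSystem M W) (i : B) (p : W × ZMod 2) :
    signedAction cs (cs.simple i) p =
      (cs.simple i * p.1 * cs.simple i, p.2 + if p.1 = cs.simple i then 1 else 0) := by
  rw [signedAction, cs.lift_apply_simple]
  rfl

theorem signedAction_mul_apply (cs : CoxeterSystem M W) (u v : W) (p : W × ZMod 2) :
    signedAction cs (u * v) p = signedAction cs u (signedAction cs v p) := by
  rw [map_mul]; rfl

theorem signedAction_apply (cs : CoxeterSystem M W) (w t : W) (ε : ZMod 2) :
    signedAction cs w (t, ε) = (w * t * w⁻¹, ε + inversionSign cs w t) := by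
  induction w using cs.simple_induction_left generalizing ε with
  | one => simp [inversionSign, map_one, Function.End.one_def]
  | mul_simple_left w i ih =>
    rw [inversionSign, signedAction_mul_apply, signedAction_mul_apply, ih, ih,
      signedAction_simple_apply, signedAction_simple_apply]
    simp [mul_assoc, add_assoc]

theorem inversionSign_mul (cs : CoxeterSystem M W) (u v t : W) :
    inversionSign cs (u * v) t = inversionSign cs v t + inversionSign cs u (v * t * v⁻¹) := by
  rw [inversionSign, signedAction_mul_apply, signedAction_apply, signedAction_apply, zero_add]

theorem inversionSign_one (cs : CoxeterSystem M W) (t : W) : inversionSign cs 1 t = 0 := by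
  simp [inversionSign, map_one, Function.End.one_def]

open Classical in
theorem inversionSign_simple (cs : CoxeterSystem M W) (i : B) (t : W) :
    inversionSign cs (cs.simple i) t = if t = cs.simple i then 1 else 0 := by
  simp [inversionSign, signedAction_simple_apply]

open Classical in
theorem inversionSign_wordProd (cs : CoxeterSystem M W) (ω : List B) (t : W) :
    inversionSign cs (cs.wordProd ω) t = ((cs.rightInvSeq ω).count t : ZMod 2) := by
  induction ω with
  | nil => simp [inversionSign_one]
  | cons i ω ih =>
    rw [cs.wordProd_cons, inversionSign_mul, ih, inversionSign_simple,
      CoxeterSystem.rightInvSeq, List.count_cons]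
    have : cs.wordProd ω * t * (cs.wordProd ω)⁻¹ = cs.simple i ↔
        (cs.wordProd ω)⁻¹ * cs.simple i * cs.wordProd ω = t := by
      constructor
      · intro h; rw [← h]; group
      · rintro rfl; group
    simp [this]

theorem inversionSign_wordProd_eq_one_iff (cs : CoxeterSystem M W) {ω : List B}
    (hω : cs.IsReduced ω) (t : W) :
    inversionSign cs (cs.wordProd ω) t = 1 ↔ t ∈ cs.rightInvSeq ω := by
  classical
  rw [inversionSign_wordProd]
  by_cases h : t ∈ cs.rightInvSeq ω
  · simp [List.count_eq_one_of_mem hω.nodup_rightInvSeq h, h]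
  · simp [List.count_eq_zero_of_not_mem h, h]

theorem zmod_two_eq_zero_or_one (a : ZMod 2) : a = 0 ∨ a = 1 := by
  revert a; decide

theorem length_mul_lt_of_inversionSign_eq_one (cs : CoxeterSystem M W) {w t : W}
    (h : inversionSign cs w t = 1) : cs.length (w * t) < cs.length w := by
  obtain ⟨ω, hω, rfl⟩ := cs.exists_isReduced w
  exact (cs.isRightInversion_of_mem_rightInvSeq hω
    ((inversionSign_wordProd_eq_one_iff cs hω t).1 h)).2

theorem inversionSign_simple_eq_one (cs : CoxeterSystem M W) {w : W} {i : B}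
    (h : cs.length (w * cs.simple i) < cs.length w) : inversionSign cs w (cs.simple i) = 1 := by
  rcases zmod_two_eq_zero_or_one (inversionSign cs w (cs.simple i)) with h0 | h1
  · have h2 : inversionSign cs (w * cs.simple i) (cs.simple i) = 1 := by
      rw [inversionSign_mul, inversionSign_simple]
      simp [h0]
    have := length_mul_lt_of_inversionSign_eq_one cs h2
    simp at this
    omega
  · exact h1

theorem length_le_of_inversionSign_imp (cs : CoxeterSystem M W) {y x : W} (f : W → W)
    (hf : Function.Injective f)
    (h : ∀ t, inversionSign cs y t = 1 → inversionSign cs x (f t) = 1) :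
    cs.length y ≤ cs.length x := by
  classical
  obtain ⟨ω, hω, rfl⟩ := cs.exists_isReduced y
  obtain ⟨ω', hω', rfl⟩ := cs.exists_isReduced x
  rw [hω.eq, hω'.eq, ← cs.length_rightInvSeq ω, ← cs.length_rightInvSeq ω',
    ← List.toFinset_card_of_nodup hω.nodup_rightInvSeq,
    ← List.toFinset_card_of_nodup hω'.nodup_rightInvSeq]
  refine Finset.card_le_card_of_injOn f ?_ hf.injOn
  intro t ht
  simp only [Finset.mem_coe, List.mem_toFinset] at ht ⊢
  rw [← inversionSign_wordProd_eq_one_iff cs hω] at ht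
  rw [← inversionSign_wordProd_eq_one_iff cs hω']
  exact h t ht

theorem inversionSign_map (cs : CoxeterSystem M W) {θ : W ≃* W} (hθ : SimpleOnto cs θ)
    (w t : W) : inversionSign cs (θ w) (θ t) = inversionSign cs w t := by
  classical
  induction w using cs.simple_induction_left with
  | one => simp [inversionSign_one]
  | mul_simple_left w i ih =>
    obtain ⟨j, hj⟩ : θ (cs.simple i) ∈ Set.range cs.simple :=
      hθ ▸ Set.mem_image_of_mem _ (Set.mem_range_self i)
    rw [map_mul, inversionSign_mul, inversionSign_mul, ih, ← hj, inversionSign_simple,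
      inversionSign_simple, hj, ← map_mul, ← map_inv, ← map_mul]
    simp only [θ.injective.eq_iff]

/-- If `z` lies in the twisted centralizer of `x`, conjugation by `z` preserves the reflections
`r` with `r * x = x * θ r` for which `θ r` is a right inversion of `x`. -/
theorem inversionSign_map_conj (cs : CoxeterSystem M W) {θ : W ≃* W} (hθ : SimpleOnto cs θ)
    {x z r : W} (hz : z * x = x * θ z) (hr : r * x = x * θ r) :
    inversionSign cs x (θ (z * r * z⁻¹)) = inversionSign cs x (θ r) := by
  have h := congrArg (fun w => inversionSign cs w (θ r)) hz
  simp only [inversionSign_mul, inversionSign_map cs hθ, ← hr, mul_inv_cancel_right] at h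
  rw [map_mul, map_mul, map_inv]
  rw [add_comm] at h
  exact (add_left_cancel h).symm

theorem mem_closure_and_conj_of_inversionSign (cs : CoxeterSystem M W) {J : Set W}
    (hJ : J ⊆ Set.range cs.simple) {y : W} (hy : y ∈ Subgroup.closure J) {t : W}
    (ht : inversionSign cs y t = 1) :
    ∃ u ∈ Subgroup.closure J, ∃ s ∈ J, t = u * s * u⁻¹ := by
  classical
  have hinv : ∀ s ∈ J, s⁻¹ = s := by
    intro s hs
    obtain ⟨i, rfl⟩ := hJ hs
    simp
  have hstep : ∀ s ∈ J, ∀ y ∈ Subgroup.closure J, (∀ t, inversionSign cs y t = 1 →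
      ∃ u ∈ Subgroup.closure J, ∃ s ∈ J, t = u * s * u⁻¹) →
      ∀ t, inversionSign cs (s * y) t = 1 →
      ∃ u ∈ Subgroup.closure J, ∃ s ∈ J, t = u * s * u⁻¹ := by
    intro s hs y hy ih t ht
    rcases zmod_two_eq_zero_or_one (inversionSign cs y t) with h0 | h1
    · obtain ⟨i, rfl⟩ := hJ hs
      rw [inversionSign_mul, h0, zero_add, inversionSign_simple] at ht
      have hts : y * t * y⁻¹ = cs.simple i := by
        by_contra hne
        simp [hne] at ht
      refine ⟨y⁻¹, inv_mem hy, cs.simple i, hs, ?_⟩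
      rw [← hts]; group
    · exact ih t h1
  induction hy using Subgroup.closure_induction_left generalizing t with
  | one => simp [inversionSign_one] at ht
  | mul_left s hs y hy ih => exact hstep s hs y hy (fun t => ih) t ht
  | inv_mul_cancel s hs y hy ih =>
    rw [hinv s hs] at ht
    exact hstep s hs y hy (fun t => ih) t ht

/-- A `W`-minimal element of a quasiparabolic class twisted-commutes with every simple
reflection that conjugates it without raising its length. -/
theorem simple_mul_eq_of_length_le (cs : CoxeterSystem M W) {θ : W ≃* W} {𝒦 : Set W}
    (hqp : IsQPClass cs θ 𝒦) {x : W} (hx : x ∈ 𝒦) (hmin : TwMin cs θ x) {i : B}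
    (h : cs.length (twConj θ (cs.simple i) x) ≤ cs.length x) :
    cs.simple i * x = x * θ (cs.simple i) := by
  have heq := hqp.1 _ (cs.isReflection_simple i) x hx
    (by rw [htL, htL, le_antisymm h (hmin i)])
  exact mul_inv_eq_iff_eq_mul.1 heq

theorem twConj_mem (θ : W ≃* W) {𝒦 : Set W} (hK : IsTwClass θ 𝒦) {y : W} (hy : y ∈ 𝒦) (w : W) :
    twConj θ w y ∈ 𝒦 := by
  obtain ⟨x₀, rfl⟩ := hK
  obtain ⟨v, rfl⟩ := hy
  exact ⟨w * v, by simp [twConj, mul_assoc]⟩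

/-- A unique `W`-minimal element has the smallest length in its class. -/
theorem length_le_of_unique_twMin (cs : CoxeterSystem M W) {θ : W ≃* W} {𝒦 : Set W}
    (hK : IsTwClass θ 𝒦) {x : W} (huniq : ∀ y ∈ 𝒦, TwMin cs θ y → y = x)
    {y : W} (hy : y ∈ 𝒦) : cs.length x ≤ cs.length y := by
  obtain ⟨m, hm, hle⟩ : ∃ m ∈ 𝒦, ∀ y ∈ 𝒦, cs.length m ≤ cs.length y := by
    have hne : 𝒦.Nonempty := ⟨y, hy⟩
    exact ⟨Function.argminOn cs.length 𝒦 hne, Function.argminOn_mem _ _ _,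
      fun a ha => Function.argminOn_le _ _ ha⟩
  rw [← huniq m hm fun i => hle _ (twConj_mem θ hK hm _)]
  exact hle y hy

/-- The parabolic subgroup generated by the left descents of a `W`-minimal element of a
quasiparabolic class contains that element. -/
theorem mem_closure_leftDescents (cs : CoxeterSystem M W) {θ : W ≃* W} (hθ : SimpleOnto cs θ)
    {𝒦 : Set W} (hqp : IsQPClass cs θ 𝒦) {x : W} (hx : x ∈ 𝒦) (hmin : TwMin cs θ x)
    {J : Set W} (hJ : J = {s | s ∈ Set.range cs.simple ∧ cs.length (s * x) < cs.length x}) :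
    x ∈ Subgroup.closure J := by
  have hJS : J ⊆ Set.range cs.simple := by rw [hJ]; exact fun s hs => hs.1
  let C : Set W := {y | ∃ w ∈ Subgroup.closure J, y = w * x}
  have hne : C.Nonempty := ⟨x, 1, one_mem _, by simp⟩
  obtain ⟨w, hw, hyw⟩ : Function.argminOn cs.length C hne ∈ C := Function.argminOn_mem _ _ _
  have hle : ∀ a ∈ C, cs.length (Function.argminOn cs.length C hne) ≤ cs.length a :=
    fun a ha => Function.argminOn_le _ _ ha
  generalize Function.argminOn cs.length C hne = y at hyw hle
  by_cases hy1 : y = 1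
  · rw [eq_inv_of_mul_eq_one_right (hyw ▸ hy1 : w * x = 1)]
    exact inv_mem hw
  exfalso
  obtain ⟨j, hj⟩ := cs.exists_rightDescent_of_ne_one hy1
  have hj' : cs.length (y * cs.simple j) < cs.length y := hj
  obtain ⟨_, ⟨i, rfl⟩, hij⟩ : cs.simple j ∈ ⇑θ '' Set.range cs.simple :=
    hθ.symm ▸ Set.mem_range_self j
  have hxy : x = w⁻¹ * y := by rw [hyw]; group
  have hshort : cs.length (x * cs.simple j) < cs.length x := by
    apply length_mul_lt_of_inversionSign_eq_one
    rcases zmod_two_eq_zero_or_one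
      (inversionSign cs w⁻¹ (y * cs.simple j * y⁻¹)) with h0 | h1
    · rw [hxy, inversionSign_mul, h0, inversionSign_simple_eq_one cs hj', add_zero]
    · exfalso
      obtain ⟨u, hu, s, hs, hus⟩ :=
        mem_closure_and_conj_of_inversionSign cs hJS (inv_mem hw) h1
      have hmem : y * cs.simple j * y⁻¹ ∈ Subgroup.closure J :=
        hus ▸ mul_mem (mul_mem hu (Subgroup.subset_closure hs)) (inv_mem hu)
      refine absurd (hle (y * cs.simple j) ⟨_, mul_mem hmem hw, ?_⟩) (not_le.2 hj')
      rw [mul_assoc, ← hyw]; group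
  have hcomm : cs.simple i * x = x * θ (cs.simple i) := by
    refine simple_mul_eq_of_length_le cs hqp hx hmin ?_
    rw [twConj, hij, cs.inv_simple, mul_assoc]
    rcases cs.length_simple_mul (x * cs.simple j) i with h | h <;> omega
  have hiJ : cs.simple i ∈ J := by
    rw [hJ]
    exact ⟨⟨i, rfl⟩, by rw [hcomm, hij]; exact hshort⟩
  refine absurd (hle (y * cs.simple j)
    ⟨_, mul_mem hw (Subgroup.subset_closure hiJ), ?_⟩) (not_le.2 hj')
  rw [mul_assoc, hcomm, hij, hyw, mul_assoc]

/-- With `x` the unique `W`-minimal element of the quasiparabolic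
`θ`-twisted conjugacy class `𝒦` and `W_J` as in Statement 11, the twisted centralizer
`{z : z·x = x·θ(z)}` equals the twisted normalizer `{z : z·W_J·θ(z)⁻¹ = W_J}`. -/
theorem stmt12 (cs : CoxeterSystem M W) (θ : W ≃* W) (hθS : SimpleOnto cs θ)
    (𝒦 : Set W) (hK : IsTwClass θ 𝒦) (hqp : IsQPClass cs θ 𝒦)
    (x : W) (hx : x ∈ 𝒦) (hmin : TwMin cs θ x)
    (huniq : ∀ y ∈ 𝒦, TwMin cs θ y → y = x)
    (SJ : Set W)
    (hSJ : SJ = {s | s ∈ Set.range cs.simple ∧ cs.length (s * x) < cs.length x}) :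
    {z : W | z * x = x * θ z} =
      {z : W | (fun h => z * h * (θ z)⁻¹) '' (Subgroup.closure SJ : Set W) =
        (Subgroup.closure SJ : Set W)} := by
  have hJS : SJ ⊆ Set.range cs.simple := by rw [hSJ]; exact fun s hs => hs.1
  have hxJ := mem_closure_leftDescents cs hθS hqp hx hmin hSJ
  have hJcomm : ∀ s ∈ SJ, s * x = x * θ s := by
    rintro s hs
    obtain ⟨⟨i, rfl⟩, hlt⟩ : s ∈ Set.range cs.simple ∧ cs.length (s * x) < cs.length x := by
      rwa [hSJ] at hs
    obtain ⟨j, hj⟩ : θ (cs.simple i) ∈ Set.range cs.simple :=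
      hθS ▸ Set.mem_image_of_mem _ (Set.mem_range_self i)
    refine simple_mul_eq_of_length_le cs hqp hx hmin ?_
    rw [twConj, ← hj, cs.inv_simple]
    rcases cs.length_mul_simple (cs.simple i * x) j with h | h <;> omega
  have hJsign : ∀ s ∈ SJ, inversionSign cs x (θ s) = 1 := by
    intro s hs
    have hlt : cs.length (s * x) < cs.length x := by rw [hSJ] at hs; exact hs.2
    obtain ⟨j, hj⟩ : θ s ∈ Set.range cs.simple := hθS ▸ Set.mem_image_of_mem _ (hJS hs)
    rw [hJcomm s hs, ← hj] at hlt
    rw [← hj]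
    exact inversionSign_simple_eq_one cs hlt
  have hWcomm : ∀ w ∈ Subgroup.closure SJ, w * x = x * θ w := by
    intro w hw
    induction hw using Subgroup.closure_induction with
    | mem s hs => exact hJcomm s hs
    | one => simp
    | mul a b _ _ ha hb => rw [mul_assoc, hb, ← mul_assoc, ha, map_mul, mul_assoc]
    | inv a _ ha => rw [map_inv, inv_mul_eq_iff_eq_mul, ← mul_assoc, ha, mul_inv_cancel_right]
  have hmax : ∀ y ∈ Subgroup.closure SJ, cs.length y ≤ cs.length x := by
    intro y hy
    refine length_le_of_inversionSign_imp cs θ θ.injective fun t ht => ?_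
    obtain ⟨u, hu, s, hs, rfl⟩ := mem_closure_and_conj_of_inversionSign cs hJS hy ht
    rw [inversionSign_map_conj cs hθS (hWcomm u hu) (hJcomm s hs), hJsign s hs]
  have hconj : ∀ z, z * x = x * θ z → ∀ h ∈ Subgroup.closure SJ,
      z * h * z⁻¹ ∈ Subgroup.closure SJ := by
    intro z hz h hh
    induction hh using Subgroup.closure_induction with
    | mem s hs =>
      obtain ⟨u, hu, s', hs', hus⟩ := mem_closure_and_conj_of_inversionSign cs hJS hxJ
        ((inversionSign_map_conj cs hθS hz (hJcomm s hs)).trans (hJsign s hs))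
      have hθmem : θ (z * s * z⁻¹) ∈ Subgroup.closure SJ :=
        hus ▸ mul_mem (mul_mem hu (Subgroup.subset_closure hs')) (inv_mem hu)
      have heq : z * s * z⁻¹ = x * θ (z * s * z⁻¹) * x⁻¹ := by
        have hz' : z⁻¹ * x = x * θ z⁻¹ := by
          rw [map_inv, inv_mul_eq_iff_eq_mul, ← mul_assoc, hz, mul_inv_cancel_right]
        rw [eq_mul_inv_iff_mul_eq, mul_assoc, hz', ← mul_assoc, mul_assoc z, hJcomm s hs,
          ← mul_assoc, hz]
        simp only [map_mul, mul_assoc]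
      rw [heq]
      exact mul_mem (mul_mem hxJ hθmem) (inv_mem hxJ)
    | one => simp
    | mul a b _ _ ha hb =>
      have : z * (a * b) * z⁻¹ = (z * a * z⁻¹) * (z * b * z⁻¹) := by group
      rw [this]
      exact mul_mem ha hb
    | inv a _ ha =>
      have : z * a⁻¹ * z⁻¹ = (z * a * z⁻¹)⁻¹ := by group
      rw [this]
      exact inv_mem ha
  ext z
  simp only [Set.mem_ofPred_eq]
  constructor
  · intro hz
    have hθz : (θ z)⁻¹ = x⁻¹ * z⁻¹ * x := by
      have : θ z = x⁻¹ * z * x := by rw [mul_assoc, hz]; group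
      rw [this]; group
    have hz' : z⁻¹ * x = x * θ z⁻¹ := by rw [map_inv, hθz]; group
    ext g
    simp only [Set.mem_image, SetLike.mem_coe, hθz]
    constructor
    · rintro ⟨h, hh, rfl⟩
      have : z * h * (x⁻¹ * z⁻¹ * x) = (z * (h * x⁻¹) * z⁻¹) * x := by group
      rw [this]
      exact mul_mem (hconj z hz _ (mul_mem hh (inv_mem hxJ))) hxJ
    · intro hg
      refine ⟨z⁻¹ * (g * x⁻¹) * z⁻¹⁻¹ * x,
        mul_mem (hconj _ hz' _ (mul_mem hg (inv_mem hxJ))) hxJ, by group⟩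
  · intro hz
    have hmem : twConj θ z x ∈ Subgroup.closure SJ := by
      rw [← SetLike.mem_coe, ← hz]
      exact ⟨x, hxJ, rfl⟩
    have heq : twConj θ z x = x := huniq _ (twConj_mem θ hK hx z) fun i =>
      (hmax _ hmem).trans (length_le_of_unique_twMin cs hK huniq
        (twConj_mem θ hK (twConj_mem θ hK hx z) _))
    exact mul_inv_eq_iff_eq_mul.1 heq

end
end
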